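/- arXiv:1707.03701 — 2 statements merged into one kernel-verified Lean document; each statement's English description precedes it below -/
import Mathlib

section
/- Let n ≥ 37, d ≥ 0 and c ≥ 4 with 4d + 3c = n. Let M3 = D^d C^c be the type-2 perfect matching of P(n,2) consisting of d consecutive blocks D followed by c consecutive blocks C, and let M4 = D^{d+3} C^{c−4} be the type-2 perfect matching consisting of d+3 consecutive blocks D followed by c−4 consecutive blocks C. Then |f(P(n,2),M3) − f(P(n,2),M4)| ≤ 1. -/
open SimpleGraph

/-- Vertices of the generalized Petersen graph `P(n,2)`:
`Sum.inl i` is the outer vertex `u_i`, `Sum.inr i` is the inner vertex `v_i`. -/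
abbrev PV (n : ℕ) := ZMod n ⊕ ZMod n

/-- The outer vertex `u_i`. -/
def pu {n : ℕ} (i : ZMod n) : PV n := Sum.inl i

/-- The inner vertex `v_i`. -/
def pv {n : ℕ} (i : ZMod n) : PV n := Sum.inr i

/-- The generalized Petersen graph `P(n,2)`, with edges
`u_i u_{i+2}`, `u_i v_i` (spokes) and `v_i v_{i+1}`, indices mod `n`. -/
def petersen (n : ℕ) : SimpleGraph (PV n) :=
  SimpleGraph.fromRel (fun x y =>
    (∃ i : ZMod n, x = pu i ∧ y = pu (i + 2)) ∨
    (∃ i : ZMod n, x = pu i ∧ y = pv i) ∨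
    (∃ i : ZMod n, x = pv i ∧ y = pv (i + 1)))

/-- `S` is a forcing set of the perfect matching `M` of `G`:
`S ⊆ M` and `S` is contained in no other perfect matching of `G`. -/
def IsForcingSet {V : Type*} (G : SimpleGraph V) (M : G.Subgraph) (S : Set (Sym2 V)) : Prop :=
  S ⊆ M.edgeSet ∧
    ∀ M' : G.Subgraph, M'.IsPerfectMatching → S ⊆ M'.edgeSet → M' = M

/-- The forcing number `f(G,M)`: the minimum cardinality of a forcing set of `M`. -/
noncomputable def forcingNumber {V : Type*} (G : SimpleGraph V) (M : G.Subgraph) : ℕ :=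
  sInf {k | ∃ S : Set (Sym2 V), IsForcingSet G M S ∧ S.ncard = k}

/-- Block `A` starting at position `i` (length 4). -/
def blockA (n : ℕ) (i : ZMod n) : Set (Sym2 (PV n)) :=
  {s(pu i, pu (i + 2)), s(pu (i + 1), pu (i + 3)), s(pv i, pv (i + 1)), s(pv (i + 2), pv (i + 3))}

/-- Block `B` at position `i` (length 1): a single spoke. -/
def blockB (n : ℕ) (i : ZMod n) : Set (Sym2 (PV n)) :=
  {s(pu i, pv i)}

/-- Block `C` starting at position `i` (length 3). -/
def blockC (n : ℕ) (i : ZMod n) : Set (Sym2 (PV n)) :=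
  {s(pu i, pu (i + 2)), s(pu (i + 1), pv (i + 1)), s(pv (i + 2), pv (i + 3))}

/-- Block `D` starting at position `i` (length 4). -/
def blockD (n : ℕ) (i : ZMod n) : Set (Sym2 (PV n)) :=
  {s(pu i, pu (i + 2)), s(pu (i + 1), pu (i + 3)), s(pv (i + 1), pv (i + 2)), s(pv (i + 3), pv (i + 4))}

/-- Length of an `A`/`B` block: `true` codes `A` (length 4), `false` codes `B` (length 1). -/
def abLen (b : Bool) : ℕ := if b then 4 else 1

/-- Edge set of a concatenation of `A`/`B` blocks starting at position `i`. -/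
def abEdges (n : ℕ) : ZMod n → List Bool → Set (Sym2 (PV n))
  | _, [] => ∅
  | i, true :: L => blockA n i ∪ abEdges n (i + 4) L
  | i, false :: L => blockB n i ∪ abEdges n (i + 1) L

/-- A perfect matching (given as a subgraph of `P(n,2)`) has type 1 if its edge set is
a cyclic concatenation of `A` and `B` blocks whose lengths sum to `n`. -/
def IsType1 {n : ℕ} (M : (petersen n).Subgraph) : Prop :=
  ∃ (i : ZMod n) (L : List Bool), (L.map abLen).sum = n ∧ M.edgeSet = abEdges n i L

/-- Length of a `C`/`D` block: `true` codes `C` (length 3), `false` codes `D` (length 4). -/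
def cdLen (b : Bool) : ℕ := if b then 3 else 4

/-- Edge set of a concatenation of `C`/`D` blocks starting at position `i`. -/
def cdEdges (n : ℕ) : ZMod n → List Bool → Set (Sym2 (PV n))
  | _, [] => ∅
  | i, true :: L => blockC n i ∪ cdEdges n (i + 3) L
  | i, false :: L => blockD n i ∪ cdEdges n (i + 4) L

/-- A perfect matching (given as a subgraph of `P(n,2)`) has type 2 if its edge set is
a cyclic concatenation of `C` and `D` blocks whose lengths sum to `n`. -/
def IsType2 {n : ℕ} (M : (petersen n).Subgraph) : Prop :=
  ∃ (i : ZMod n) (L : List Bool), (L.map cdLen).sum = n ∧ M.edgeSet = cdEdges n i L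

namespace PetersenWord

/-- A letter records, at a position `i`, which of the edges `u_i v_i`, `u_i u_{i+2}`, `v_i v_{i+1}`
are selected. A state records, before position `i`, which of the edges `v_{i-1} v_i`,
`u_{i-2} u_i`, `u_{i-1} u_{i+1}` are selected. -/
abbrev Triple := Bool × Bool × Bool

def exactlyOne (x y z : Bool) : Bool :=
  (x && !y && !z) || (!x && y && !z) || (!x && !y && z)

/-- Both `u_i` and `v_i` are covered exactly once when letter `l` is read in state `q`. -/
def admits (q l : Triple) : Bool :=
  exactlyOne q.2.1 l.2.1 l.1 && exactlyOne q.1 l.1 l.2.2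

def next (q l : Triple) : Triple := (l.2.2, q.2.2, l.2.1)

/-- The edges selected by `f` are selected by `l`. -/
def below (f l : Triple) : Bool := (!f.1 || l.1) && (!f.2.1 || l.2.1) && (!f.2.2 || l.2.2)

def same (f l : Triple) : Bool := below f l && below l f

def weight (f : Triple) : ℕ := f.1.toNat + f.2.1.toNat + f.2.2.toNat

def code (q : Triple) : ℕ := q.1.toNat + 2 * q.2.1.toNat + 4 * q.2.2.toNat

def triples : List Triple :=
  [(false, false, false), (false, false, true), (false, true, false), (false, true, true),
   (true, false, false), (true, false, true), (true, true, false), (true, true, true)]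

/-- The state at the boundary between two blocks of type `C` or `D`. -/
def base : Triple := (true, false, false)

def moves (f : Triple) : List (Triple × Triple) :=
  (triples ×ˢ triples).filter fun t => admits t.1 t.2 && below f t.2

def entry (a b : Triple) : ℕ := 8 * code b + code a

def orAll {α : Type*} (g : α → ℕ) (L : List α) : ℕ := L.foldr (fun t acc => g t ||| acc) 0

/-- Update of the set `R` of (start, end) state pairs of deviating runs after reading a letter of
a forcing word, where `q` is the state of the reference run, `m` its next letter, and `f` the set
of prescribed edges at this position. -/
def extendBits (q m f : Triple) (R : ℕ) : ℕ :=
  orAll (fun t => ((R >>> (8 * code t.1)) &&& 255) <<< (8 * code (next t.1 t.2))) (moves f) |||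
  orAll (fun l => 2 ^ entry base (next q l))
    (triples.filter fun l => admits q l && below f l && !same l m)

def dominates (x y : ℕ × ℕ) : Bool := Nat.ble x.1 y.1 && Nat.beq (x.2 &&& y.2) x.2

/-- Discard the dominated pairs of a list. -/
def prune (L : List (ℕ × ℕ)) : List (ℕ × ℕ) :=
  L.foldr (fun x acc => bif acc.any (dominates · x) then acc
    else x :: acc.filter (fun y => !dominates x y)) []

def candidates (q m : Triple) (L : List (ℕ × ℕ)) : List (ℕ × ℕ) :=
  (triples.filter (below · m)).flatMap fun f =>
    L.map fun e => (weight f + e.1, extendBits q m f e.2)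

def advance (s : Triple × List (ℕ × ℕ)) (m : Triple) : Triple × List (ℕ × ℕ) :=
  (next s.1 m, prune (candidates s.1 m s.2))

def initialBits : ℕ :=
  orAll (fun a => 2 ^ entry a a) (triples.filter fun a => !same a base)

/-- The reference state after reading `w` and the Pareto-minimal pairs (cost, deviation set) of
sets of prescribed edges of `w`. -/
def sweep (w : List Triple) : Triple × List (ℕ × ℕ) :=
  w.foldl advance (base, [(0, initialBits)])

def wordC : List Triple := [(false, true, false), (true, false, false), (false, false, true)]
def wordD : List Triple :=
  [(false, true, false), (false, true, true), (false, false, false), (false, false, true)]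

/-- Every choice of prescribed edges in `w` that forces `w` as a closed run can be matched by one in
`w'` costing at most one more and allowing no new deviation. -/
def replaceable (w w' : List Triple) : Bool :=
  (sweep w).2.all fun e => e.2.testBit (entry base base) ||
    (sweep w').2.any fun e' => dominates e' (e.1 + 1, e.2)

/-- The word of a concatenation of blocks, `true` coding `C` and `false` coding `D`. -/
def word (L : List Bool) : List Triple := L.flatMap fun b => bif b then wordC else wordD

/-- `Run a w b`: the word `w` leads from state `a` to state `b`, covering every vertex once. -/
def Run : Triple → List Triple → Triple → Prop
  | a, [], b => a = b
  | a, l :: w, b => admits a l = true ∧ Run (next a l) w b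

abbrev Under (S w : List Triple) : Prop := List.Forall₂ (fun f l => below f l = true) S w

def totalWeight (S : List Triple) : ℕ := (S.map weight).sum

/-- Some run from `a` to `b` compatible with `S` differs from the reference run of `m`. -/
def Deviates (m S : List Triple) (a b : Triple) : Prop :=
  ∃ w, Under S w ∧ Run a w b ∧ ¬(a = base ∧ w = m)

theorem run_append {a b : Triple} {w w' : List Triple} :
    Run a (w ++ w') b ↔ ∃ c, Run a w c ∧ Run c w' b := by
  induction w generalizing a with
  | nil => simp [Run]
  | cons l w ih => simp [Run, ih, and_assoc]

theorem Run.eq_foldl {a b : Triple} {w : List Triple} (h : Run a w b) : b = w.foldl next a := by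
  induction w generalizing a with
  | nil => exact h.symm
  | cons l w ih => exact ih h.2

theorem Under.length_eq {S w : List Triple} (h : Under S w) : S.length = w.length :=
  List.Forall₂.length_eq h

theorem under_append {S S' w w' : List Triple} (h : Under S w) (h' : Under S' w') :
    Under (S ++ S') (w ++ w') := List.rel_append h h'

theorem exists_of_under_append_right {S w w' : List Triple} (h : Under S (w ++ w')) :
    ∃ T T', S = T ++ T' ∧ Under T w ∧ Under T' w' :=
  ⟨_, _, (List.take_append_drop w.length S).symm, List.forall₂_take_append _ _ _ h,
    List.forall₂_drop_append _ _ _ h⟩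

theorem exists_of_under_append_left {S S' w : List Triple} (h : Under (S ++ S') w) :
    ∃ v v', w = v ++ v' ∧ Under S v ∧ Under S' v' := by
  obtain ⟨v, v', rfl, h1, h2⟩ : ∃ v v', w = v ++ v' ∧
      List.Forall₂ (fun l f => below f l = true) v S ∧
      List.Forall₂ (fun l f => below f l = true) v' S' :=
    ⟨_, _, (List.take_append_drop S.length w).symm, List.forall₂_take_append _ _ _ h.flip,
      List.forall₂_drop_append _ _ _ h.flip⟩
  exact ⟨v, v', rfl, h1.flip, h2.flip⟩

theorem totalWeight_append (S S' : List Triple) :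
    totalWeight (S ++ S') = totalWeight S + totalWeight S' := by
  simp [totalWeight]

theorem mem_triples (t : Triple) : t ∈ triples := by
  revert t; decide

theorem same_eq_decide (f l : Triple) : same f l = decide (f = l) := by
  revert f l; decide

theorem code_lt (a : Triple) : code a < 8 := by
  revert a; decide

theorem code_inj {a b : Triple} : code a = code b ↔ a = b := by
  revert a b; decide

theorem entry_inj {a b c d : Triple} : entry a b = entry c d ↔ a = c ∧ b = d := by
  have := code_lt a
  have := code_lt c
  rw [← code_inj, ← code_inj (a := b)]
  unfold entry
  omega

theorem testBit_orAll {α : Type*} (g : α → ℕ) (L : List α) (i : ℕ) :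
    (orAll g L).testBit i = true ↔ ∃ t ∈ L, (g t).testBit i = true := by
  induction L with
  | nil => simp [orAll]
  | cons t L ih =>
    change (g t ||| orAll g L).testBit i = true ↔ _
    simp [ih]

theorem testBit_two_pow_entry {a b c d : Triple} :
    (2 ^ entry a b).testBit (entry c d) = true ↔ a = c ∧ b = d := by
  rw [Nat.testBit_two_pow, decide_eq_true_iff, entry_inj]

theorem testBit_initialBits (a b : Triple) :
    initialBits.testBit (entry a b) = true ↔ Deviates [] [] a b := by
  simp only [initialBits, testBit_orAll, testBit_two_pow_entry, List.mem_filter, mem_triples,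
    true_and, Deviates]
  constructor
  · rintro ⟨c, hc, rfl, rfl⟩
    refine ⟨[], .nil, rfl, fun h => ?_⟩
    simp [same_eq_decide, h.1] at hc
  · rintro ⟨w, hw, hr, hd⟩
    cases hw
    refine ⟨a, ?_, rfl, hr⟩
    simpa [same_eq_decide] using hd

theorem testBit_column (R : ℕ) (a b c d : Triple) :
    (((R >>> (8 * code b)) &&& 255) <<< (8 * code d)).testBit (entry a c) = true ↔
      d = c ∧ R.testBit (entry a b) = true := by
  have ha := code_lt a
  have h255 : 255 = 2 ^ 8 - 1 := rfl
  rw [← code_inj (a := d), Nat.testBit_shiftLeft, Nat.testBit_and, Nat.testBit_shiftRight, h255,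
    Nat.testBit_two_pow_sub_one]
  unfold entry
  by_cases h : code d = code c
  · simp [h, ha]
  · have : ¬ (8 * code d ≤ 8 * code c + code a ∧ 8 * code c + code a - 8 * code d < 8) := by omega
    simp only [h, false_and, iff_false]
    simp only [Bool.and_eq_true, decide_eq_true_eq]
    tauto

theorem mem_moves {f b l : Triple} :
    (b, l) ∈ moves f ↔ admits b l = true ∧ below f l = true := by
  simp only [moves, List.mem_filter, Bool.and_eq_true, and_iff_right_iff_imp]
  exact fun _ => List.pair_mem_product.2 ⟨mem_triples b, mem_triples l⟩

theorem testBit_extendBits (q m f : Triple) (R : ℕ) (a c : Triple) :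
    (extendBits q m f R).testBit (entry a c) = true ↔
      (∃ b l, admits b l = true ∧ below f l = true ∧ next b l = c ∧
        R.testBit (entry a b) = true) ∨
      (a = base ∧ ∃ l, admits q l = true ∧ below f l = true ∧ l ≠ m ∧ next q l = c) := by
  simp only [extendBits, Nat.testBit_or, Bool.or_eq_true, testBit_orAll, testBit_column,
    testBit_two_pow_entry]
  refine or_congr ⟨?_, ?_⟩ ⟨?_, ?_⟩
  · rintro ⟨⟨b, l⟩, ht, h3, h4⟩
    obtain ⟨h1, h2⟩ := mem_moves.1 ht
    exact ⟨b, l, h1, h2, h3, h4⟩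
  · rintro ⟨b, l, h1, h2, h3, h4⟩
    exact ⟨(b, l), mem_moves.2 ⟨h1, h2⟩, h3, h4⟩
  · rintro ⟨l, hl, rfl, h4⟩
    have := (List.mem_filter.1 hl).2
    simp only [same_eq_decide, Bool.and_eq_true, Bool.not_eq_true', decide_eq_false_iff_not] at this
    exact ⟨rfl, l, this.1.1, this.1.2, this.2, h4⟩
  · rintro ⟨rfl, l, h1, h2, h3, h4⟩
    exact ⟨l, List.mem_filter.2 ⟨mem_triples l, by simp [same_eq_decide, h1, h2, h3]⟩, rfl, h4⟩

theorem deviates_snoc {m S : List Triple} {x f q a c : Triple} (hm : Run base m q)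
    (hS : Under S m) :
    Deviates (m ++ [x]) (S ++ [f]) a c ↔
      (∃ b l, admits b l = true ∧ below f l = true ∧ next b l = c ∧ Deviates m S a b) ∨
      (a = base ∧ ∃ l, admits q l = true ∧ below f l = true ∧ l ≠ x ∧ next q l = c) := by
  constructor
  · rintro ⟨w, hw, hr, hd⟩
    obtain ⟨v, v', rfl, hv, hv'⟩ := exists_of_under_append_left hw
    obtain ⟨l, hl, rfl⟩ : ∃ l, below f l = true ∧ v' = [l] := by
      cases hv' with
      | cons h t => cases t; exact ⟨_, h, rfl⟩
    obtain ⟨b, hb, hadm, hnext⟩ := run_append.1 hr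
    by_cases h : a = base ∧ v = m
    · obtain ⟨rfl, rfl⟩ := h
      obtain rfl : b = q := hb.eq_foldl.trans hm.eq_foldl.symm
      exact .inr ⟨rfl, l, hadm, hl, fun hlx => hd ⟨rfl, by rw [hlx]⟩, hnext⟩
    · exact .inl ⟨b, l, hadm, hl, hnext, v, hv, hb, h⟩
  · rintro (⟨b, l, hadm, hl, hnext, v, hv, hb, h⟩ | ⟨rfl, l, hadm, hl, hlx, hnext⟩)
    · refine ⟨v ++ [l], under_append hv (.cons hl .nil), run_append.2 ⟨b, hb, hadm, hnext⟩, ?_⟩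
      rintro ⟨ha, hvm⟩
      exact h ⟨ha, (List.append_inj' hvm rfl).1⟩
    · refine ⟨m ++ [l], under_append hS (.cons hl .nil), run_append.2 ⟨q, hm, hadm, hnext⟩, ?_⟩
      rintro ⟨-, hvm⟩
      exact hlx (by simpa using hvm)

theorem dominates_iff {x y : ℕ × ℕ} :
    dominates x y = true ↔ x.1 ≤ y.1 ∧ x.2 &&& y.2 = x.2 := by
  simp [dominates]

theorem dominates_refl (x : ℕ × ℕ) : dominates x x = true := by
  simp [dominates_iff]

theorem dominates_trans {x y z : ℕ × ℕ} (h : dominates x y = true) (h' : dominates y z = true) :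
    dominates x z = true := by
  rw [dominates_iff] at *
  refine ⟨h.1.trans h'.1, ?_⟩
  rw [← h.2, Nat.land_assoc, h'.2]

theorem testBit_of_dominates {x y : ℕ × ℕ} (h : dominates x y = true) {i : ℕ}
    (hi : x.2.testBit i = true) : y.2.testBit i = true := by
  rw [← (dominates_iff.1 h).2, Nat.testBit_and, Bool.and_eq_true] at hi
  exact hi.2

theorem mem_of_mem_prune {L : List (ℕ × ℕ)} {x : ℕ × ℕ} (h : x ∈ prune L) : x ∈ L := by
  induction L with
  | nil => exact h
  | cons y L ih =>
    change x ∈ bif (prune L).any (dominates · y) then prune L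
      else y :: (prune L).filter (fun z => !dominates y z) at h
    cases hb : (prune L).any (dominates · y) <;> rw [hb] at h
    · rcases List.mem_cons.1 h with rfl | h
      · exact List.mem_cons_self
      · exact List.mem_cons_of_mem _ (ih (List.mem_filter.1 h).1)
    · exact List.mem_cons_of_mem _ (ih h)

theorem exists_mem_prune {L : List (ℕ × ℕ)} {x : ℕ × ℕ} (h : x ∈ L) :
    ∃ y ∈ prune L, dominates y x = true := by
  induction L with
  | nil => cases h
  | cons y L ih =>
    change ∃ z ∈ bif (prune L).any (dominates · y) then prune L
      else y :: (prune L).filter (fun z => !dominates y z), dominates z x = true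
    cases hb : (prune L).any (dominates · y)
    · rcases List.mem_cons.1 h with rfl | h
      · exact ⟨x, List.mem_cons_self, dominates_refl x⟩
      · obtain ⟨z, hz, hzx⟩ := ih h
        by_cases hyz : dominates y z = true
        · exact ⟨y, List.mem_cons_self, dominates_trans hyz hzx⟩
        · exact ⟨z, List.mem_cons_of_mem _ (List.mem_filter.2 ⟨hz, by simpa using hyz⟩), hzx⟩
    · rcases List.mem_cons.1 h with rfl | h
      · simpa using hb
      · exact ih h

theorem mem_candidates {q m : Triple} {L : List (ℕ × ℕ)} {x : ℕ × ℕ} :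
    x ∈ candidates q m L ↔ ∃ f, below f m = true ∧ ∃ e ∈ L,
      (weight f + e.1, extendBits q m f e.2) = x := by
  simp only [candidates, List.mem_flatMap, List.mem_filter, mem_triples, true_and, List.mem_map]

theorem sweep_append (w : List Triple) (x : Triple) :
    sweep (w ++ [x]) = advance (sweep w) x := by
  simp [sweep]

theorem sweep_fst (w : List Triple) : (sweep w).1 = w.foldl next base := by
  induction w using List.reverseRecOn with
  | nil => rfl
  | append_singleton w x ih => simp [sweep_append, advance, ih]

theorem exists_mem_sweep {m S : List Triple} {q : Triple} (hm : Run base m q) (hS : Under S m) :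
    ∃ e ∈ (sweep m).2, e.1 ≤ totalWeight S ∧
      ∀ a b, e.2.testBit (entry a b) = true → Deviates m S a b := by
  induction m using List.reverseRecOn generalizing S q with
  | nil =>
    cases hS
    exact ⟨_, List.mem_singleton_self _, le_rfl, fun a b => (testBit_initialBits a b).1⟩
  | append_singleton m x ih =>
    obtain ⟨T, T', rfl, hT, hT'⟩ := exists_of_under_append_right hS
    obtain ⟨f, hf, rfl⟩ : ∃ f, below f x = true ∧ T' = [f] := by
      cases hT' with
      | cons h t => cases t; exact ⟨_, h, rfl⟩
    obtain ⟨p, hp, -⟩ := run_append.1 hm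
    obtain ⟨e, he, hle, hbits⟩ := ih hp hT
    obtain ⟨e', he', hdom⟩ := exists_mem_prune
      (mem_candidates (q := (sweep m).1).2 ⟨f, hf, e, he, rfl⟩)
    rw [sweep_append]
    refine ⟨e', he', (dominates_iff.1 hdom).1.trans ?_, fun a c hac => ?_⟩
    · rw [totalWeight_append]
      simp only [totalWeight, List.map_cons, List.map_nil, List.sum_singleton] at hle ⊢
      omega
    · have := testBit_of_dominates hdom hac
      rw [testBit_extendBits, sweep_fst, ← hp.eq_foldl] at this
      rw [deviates_snoc hp hT]
      exact this.imp_left fun ⟨b, l, h1, h2, h3, h4⟩ => ⟨b, l, h1, h2, h3, hbits a b h4⟩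

theorem exists_of_mem_sweep {m : List Triple} {q : Triple} (hm : Run base m q) {e : ℕ × ℕ}
    (he : e ∈ (sweep m).2) :
    ∃ S, Under S m ∧ totalWeight S = e.1 ∧
      ∀ a b, Deviates m S a b → e.2.testBit (entry a b) = true := by
  induction m using List.reverseRecOn generalizing e q with
  | nil =>
    obtain rfl := List.mem_singleton.1 he
    exact ⟨[], .nil, rfl, fun a b => (testBit_initialBits a b).2⟩
  | append_singleton m x ih =>
    rw [sweep_append] at he
    obtain ⟨f, hf, e, hmem, rfl⟩ := mem_candidates.1 (mem_of_mem_prune he)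
    obtain ⟨p, hp, -⟩ := run_append.1 hm
    obtain ⟨S, hS, hwt, hbits⟩ := ih hp hmem
    refine ⟨S ++ [f], under_append hS (.cons hf .nil), ?_, fun a c hac => ?_⟩
    · rw [totalWeight_append, hwt, add_comm]
      simp [totalWeight]
    · rw [deviates_snoc hp hS] at hac
      rw [testBit_extendBits, sweep_fst, ← hp.eq_foldl]
      exact hac.imp_left fun ⟨b, l, h1, h2, h3, h4⟩ => ⟨b, l, h1, h2, h3, hbits a b h4⟩

theorem exists_replacement {m m' S : List Triple} (h : replaceable m m' = true)
    (hm : Run base m base) (hm' : Run base m' base) (hS : Under S m)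
    (hdev : ¬ Deviates m S base base) :
    ∃ S', Under S' m' ∧ totalWeight S' ≤ totalWeight S + 1 ∧
      ∀ a b, Deviates m' S' a b → Deviates m S a b := by
  obtain ⟨e, he, hle, hbits⟩ := exists_mem_sweep hm hS
  rcases Bool.or_eq_true_iff.1 (List.all_eq_true.1 h e he) with h | h
  · exact absurd (hbits _ _ h) hdev
  · obtain ⟨e', he', hdom⟩ := List.any_eq_true.1 h
    obtain ⟨S', hS', hwt, hbits'⟩ := exists_of_mem_sweep hm' he'
    refine ⟨S', hS', ?_, fun a b hab =>
      hbits a b (testBit_of_dominates hdom (hbits' a b hab))⟩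
    have := (dominates_iff.1 hdom).1
    simp only at this
    omega

/-- `S` is contained in `m` and in no other closed run. -/
def Forces (m S : List Triple) : Prop :=
  Under S m ∧ ∀ w q, Under S w → Run q w q → w = m

theorem Forces.transfer {pre post m m' S : List Triple} {q : Triple}
    (h : replaceable m m' = true) (hm : ∀ a b, Run a m b ↔ a = base ∧ b = base)
    (hm' : Run base m' base) (hpre : Run q pre base) (hpost : Run base post q)
    (hS : Forces (pre ++ (m ++ post)) S) :
    ∃ S', Forces (pre ++ (m' ++ post)) S' ∧ totalWeight S' ≤ totalWeight S + 1 := by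
  have hm0 : Run base m base := (hm _ _).2 ⟨rfl, rfl⟩
  obtain ⟨hle, huniq⟩ := hS
  obtain ⟨T, U, rfl, hT, hU⟩ := exists_of_under_append_right hle
  obtain ⟨S, U, rfl, hS, hU⟩ := exists_of_under_append_right hU
  have cancel : ∀ {v w u : List Triple}, Under T v → Under S w →
      v ++ (w ++ u) = pre ++ (m ++ post) → v = pre ∧ w = m ∧ u = post := by
    intro v w u hv hw he
    obtain ⟨h1, h2⟩ := List.append_inj he (hv.length_eq.symm.trans hT.length_eq)
    obtain ⟨h3, h4⟩ := List.append_inj h2 (hw.length_eq.symm.trans hS.length_eq)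
    exact ⟨h1, h3, h4⟩
  obtain ⟨S', hS', hwt, hdev⟩ := exists_replacement h hm0 hm' hS (by
    rintro ⟨w, hw, hr, hne⟩
    exact hne ⟨rfl, (cancel hT hw (huniq _ q (under_append hT (under_append hw hU))
      (run_append.2 ⟨_, hpre, run_append.2 ⟨_, hr, hpost⟩⟩))).2.1⟩)
  refine ⟨T ++ (S' ++ U), ⟨under_append hT (under_append hS' hU), fun l p hl hp => ?_⟩, ?_⟩
  · obtain ⟨v, l, rfl, hv, hl⟩ := exists_of_under_append_left hl
    obtain ⟨w, u, rfl, hw, hu⟩ := exists_of_under_append_left hl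
    obtain ⟨a, hpa, hp⟩ := run_append.1 hp
    obtain ⟨b, hab, hbp⟩ := run_append.1 hp
    by_cases hcase : a = base ∧ w = m'
    · obtain ⟨rfl, rfl⟩ := hcase
      obtain rfl : b = base := hab.eq_foldl.trans hm'.eq_foldl.symm
      obtain ⟨rfl, -, rfl⟩ := cancel hv hS (huniq _ p (under_append hv (under_append hS hu))
        (run_append.2 ⟨_, hpa, run_append.2 ⟨_, hm0, hbp⟩⟩))
      rfl
    · obtain ⟨w', hw', hr, hne⟩ := hdev a b ⟨w, hw, hab, hcase⟩
      obtain ⟨-, rfl, -⟩ := cancel hv hw' (huniq _ p (under_append hv (under_append hw' hu))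
        (run_append.2 ⟨_, hpa, run_append.2 ⟨_, hr, hbp⟩⟩))
      exact absurd ⟨((hm _ _).1 hr).1, rfl⟩ hne
  · simp only [totalWeight_append]
    omega

theorem run_word_base (L : List Bool) : Run base (word L) base := by
  induction L with
  | nil => rfl
  | cons b L ih =>
    refine run_append.2 ⟨base, ?_, ih⟩
    cases b <;> simp [Run, wordC, wordD, base, admits, next, exactlyOne]

theorem run_word_iff {L : List Bool} (hL : L ≠ []) {a b : Triple} :
    Run a (word L) b ↔ a = base ∧ b = base := by
  refine ⟨fun h => ?_, fun h => h.1 ▸ h.2 ▸ run_word_base L⟩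
  have key : a = base := by
    obtain ⟨x, L, rfl⟩ := List.exists_cons_of_ne_nil hL
    obtain ⟨c, hc, -⟩ := run_append.1 h
    obtain ⟨u, v, w⟩ := a
    revert hc
    cases x <;> cases u <;> cases v <;> cases w <;>
      simp [Run, wordC, wordD, base, admits, next, exactlyOne]
  subst key
  exact ⟨rfl, h.eq_foldl.trans (run_word_base L).eq_foldl.symm⟩

theorem word_append (L L' : List Bool) : word (L ++ L') = word L ++ word L' := by
  simp [word]

theorem Forces.transfer_word {P Q L L' : List Bool} {S : List Triple} (hL : L ≠ [])
    (h : replaceable (word L) (word L') = true) (hS : Forces (word (P ++ (L ++ Q))) S) :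
    ∃ S', Forces (word (P ++ (L' ++ Q))) S' ∧ totalWeight S' ≤ totalWeight S + 1 := by
  simp only [word_append] at hS ⊢
  exact hS.transfer h (fun a b => run_word_iff hL) (run_word_base L') (run_word_base P)
    (run_word_base Q)

theorem replaceable_DCCCC_DDDD : replaceable (word [false, true, true, true, true])
    (word [false, false, false, false]) = true := by decide +kernel

theorem replaceable_CCCCCC_DDDCC : replaceable (word [true, true, true, true, true, true])
    (word [false, false, false, true, true]) = true := by decide +kernel

theorem replaceable_DDD_CCCC : replaceable (word [false, false, false])
    (word [true, true, true, true]) = true := by decide +kernel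

theorem Forces.replicate_forward {d c : ℕ} (hc : 4 ≤ c) (h : 0 < d ∨ 6 ≤ c) {S : List Triple}
    (hS : Forces (word (List.replicate d false ++ List.replicate c true)) S) :
    ∃ S', Forces (word (List.replicate (d + 3) false ++ List.replicate (c - 4) true)) S' ∧
      totalWeight S' ≤ totalWeight S + 1 := by
  rcases h with h | h
  · obtain ⟨d, rfl⟩ := Nat.exists_eq_add_of_lt h
    obtain ⟨c, rfl⟩ := Nat.exists_eq_add_of_le hc
    have := transfer_word (P := List.replicate d false) (Q := List.replicate c true)
      (by simp) replaceable_DCCCC_DDDD (S := S) (by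
        convert hS using 2
        rw [zero_add, List.replicate_add d, List.replicate_add 4]; simp [List.replicate])
    convert this using 5
    rw [zero_add, add_assoc, List.replicate_add d]; simp [List.replicate]
  · obtain ⟨c, rfl⟩ := Nat.exists_eq_add_of_le h
    have := transfer_word (P := List.replicate d false) (Q := List.replicate c true)
      (by simp) replaceable_CCCCCC_DDDCC (S := S) (by
        convert hS using 2
        rw [List.replicate_add 6]; simp [List.replicate])
    convert this using 5
    rw [List.replicate_add d, show 6 + c - 4 = 2 + c by omega, List.replicate_add 2]
    simp [List.replicate]

theorem Forces.replicate_backward {d c : ℕ} (hc : 4 ≤ c) {S : List Triple}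
    (hS : Forces (word (List.replicate (d + 3) false ++ List.replicate (c - 4) true)) S) :
    ∃ S', Forces (word (List.replicate d false ++ List.replicate c true)) S' ∧
      totalWeight S' ≤ totalWeight S + 1 := by
  obtain ⟨c, rfl⟩ := Nat.exists_eq_add_of_le hc
  have := transfer_word (P := List.replicate d false) (Q := List.replicate c true)
    (by simp) replaceable_DDD_CCCC (S := S) (by
      convert hS using 2
      rw [List.replicate_add d, show 4 + c - 4 = c by omega]; simp [List.replicate])
  convert this using 5
  rw [List.replicate_add 4]; simp [List.replicate]

variable {n : ℕ}

/-- The edges selected by the letter `l` at position `i`. -/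
def letterEdges (n : ℕ) (i : ZMod n) (l : Triple) : Set (Sym2 (PV n)) :=
  {e | (l.1 = true ∧ e = s(pu i, pv i)) ∨ (l.2.1 = true ∧ e = s(pu i, pu (i + 2))) ∨
    (l.2.2 = true ∧ e = s(pv i, pv (i + 1)))}

/-- The edges selected by a word starting at position `i`. -/
def wordEdges (n : ℕ) : ZMod n → List Triple → Set (Sym2 (PV n))
  | _, [] => ∅
  | i, l :: w => letterEdges n i l ∪ wordEdges n (i + 1) w

open Classical in
noncomputable def readLetter (T : Set (Sym2 (PV n))) (i : ZMod n) : Triple :=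
  (decide (s(pu i, pv i) ∈ T), decide (s(pu i, pu (i + 2)) ∈ T), decide (s(pv i, pv (i + 1)) ∈ T))

noncomputable def readWord (T : Set (Sym2 (PV n))) : ZMod n → ℕ → List Triple
  | _, 0 => []
  | i, k + 1 => readLetter T i :: readWord T (i + 1) k

noncomputable def stateAt (T : Set (Sym2 (PV n))) (i : ZMod n) : Triple :=
  ((readLetter T (i - 1)).2.2, (readLetter T (i - 2)).2.1, (readLetter T (i - 1)).2.1)

theorem add_one_add_natCast (i : ZMod n) (k : ℕ) : i + 1 + k = i + (k + 1 : ℕ) := by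
  push_cast
  ring

theorem wordEdges_append (i : ZMod n) (w w' : List Triple) :
    wordEdges n i (w ++ w') = wordEdges n i w ∪ wordEdges n (i + w.length) w' := by
  induction w generalizing i with
  | nil => simp [wordEdges]
  | cons l w ih => simp only [List.cons_append, wordEdges, ih, Set.union_assoc, add_one_add_natCast,
      List.length_cons]

theorem wordEdges_wordC (i : ZMod n) : wordEdges n i wordC = blockC n i := by
  ext e
  simp [wordEdges, wordC, letterEdges, blockC, add_assoc, one_add_one_eq_two]
  norm_num
  tauto

theorem wordEdges_wordD (i : ZMod n) : wordEdges n i wordD = blockD n i := by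
  ext e
  simp [wordEdges, wordD, letterEdges, blockD, add_assoc, one_add_one_eq_two]
  norm_num
  tauto

theorem cdEdges_eq_wordEdges (i : ZMod n) (L : List Bool) :
    cdEdges n i L = wordEdges n i (word L) := by
  induction L generalizing i with
  | nil => rfl
  | cons b L ih =>
    cases b
    · change _ = wordEdges n i (wordD ++ word L)
      rw [wordEdges_append, wordEdges_wordD, cdEdges, ih]
      simp [wordD]
    · change _ = wordEdges n i (wordC ++ word L)
      rw [wordEdges_append, wordEdges_wordC, cdEdges, ih]
      simp [wordC]

theorem mem_wordEdges {e : Sym2 (PV n)} {i : ZMod n} {w : List Triple} :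
    e ∈ wordEdges n i w ↔ ∃ (k : ℕ) (l : Triple), w[k]? = some l ∧ e ∈ letterEdges n (i + (k : ZMod n)) l := by
  induction w generalizing i with
  | nil => simp [wordEdges]
  | cons l w ih =>
    rw [wordEdges, Set.mem_union, ih]
    constructor
    · rintro (h | ⟨k, x, hx, h⟩)
      · exact ⟨0, l, rfl, by simpa using h⟩
      · exact ⟨k + 1, x, hx, by rwa [← add_one_add_natCast]⟩
    · rintro ⟨_ | k, x, hx, h⟩
      · obtain rfl : l = x := by simpa using hx
        exact .inl (by simpa using h)
      · exact .inr ⟨k, x, hx, by rwa [add_one_add_natCast]⟩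

theorem natCast_ne_zero {k : ℕ} (hn : 5 ≤ n) (h0 : 0 < k) (h : k < 5) : (k : ZMod n) ≠ 0 := by
  rw [Ne, ZMod.natCast_eq_zero_iff]
  exact fun hd => absurd (Nat.le_of_dvd h0 hd) (by omega)

theorem letterEdges_index {e : Sym2 (PV n)} (hn : 5 ≤ n) {i j : ZMod n} {a b : Triple}
    (ha : e ∈ letterEdges n i a) (hb : e ∈ letterEdges n j b) : i = j := by
  have h2 : (2 : ZMod n) ≠ 0 := mod_cast natCast_ne_zero (k := 2) hn (by norm_num) (by norm_num)
  have h4 : (4 : ZMod n) ≠ 0 := mod_cast natCast_ne_zero (k := 4) hn (by norm_num) (by norm_num)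
  rcases ha with ⟨-, rfl⟩ | ⟨-, rfl⟩ | ⟨-, rfl⟩ <;> rcases hb with ⟨-, h⟩ | ⟨-, h⟩ | ⟨-, h⟩ <;>
    simp only [pu, pv, Sym2.eq_iff, Sum.inl.injEq, Sum.inr.injEq, reduceCtorEq, false_and,
      and_false, or_false] at h
  · exact h.1
  · rcases h with h | ⟨h, h'⟩
    · exact h.1
    · exact absurd (by linear_combination h' - h) h4
  · rcases h with h | ⟨h, h'⟩
    · exact h.1
    · exact absurd (by linear_combination h' - h) h2

theorem spoke_mem_letterEdges {i : ZMod n} {l : Triple} :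
    s(pu i, pv i) ∈ letterEdges n i l ↔ l.1 = true := by
  simp [letterEdges, pu, pv]

theorem outer_mem_letterEdges {i : ZMod n} {l : Triple} :
    s(pu i, pu (i + 2)) ∈ letterEdges n i l ↔ l.2.1 = true := by
  simp [letterEdges, pu, pv]

theorem inner_mem_letterEdges {i : ZMod n} {l : Triple} :
    s(pv i, pv (i + 1)) ∈ letterEdges n i l ↔ l.2.2 = true := by
  simp [letterEdges, pu, pv]

theorem mem_wordEdges_iff_of_mem {e : Sym2 (PV n)} (hn : 5 ≤ n) {w : List Triple}
    (hw : w.length ≤ n) {k : ℕ} (hk : k < w.length) {i : ZMod n} {a : Triple}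
    (he : e ∈ letterEdges n (i + k) a) :
    e ∈ wordEdges n i w ↔ e ∈ letterEdges n (i + k) w[k] := by
  rw [mem_wordEdges]
  constructor
  · rintro ⟨j, l, hj, h⟩
    obtain ⟨hjw, rfl⟩ := List.getElem?_eq_some_iff.1 hj
    have hkj : (k : ZMod n) = j := add_left_cancel (letterEdges_index hn he h)
    rw [ZMod.natCast_eq_natCast_iff', Nat.mod_eq_of_lt (hk.trans_le hw),
      Nat.mod_eq_of_lt (hjw.trans_le hw)] at hkj
    subst hkj
    exact h
  · exact fun h => ⟨k, _, List.getElem?_eq_getElem hk, h⟩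

theorem readLetter_wordEdges (hn : 5 ≤ n) {w : List Triple} (hw : w.length ≤ n) {k : ℕ}
    (hk : k < w.length) (i : ZMod n) : readLetter (wordEdges n i w) (i + k) = w[k] := by
  have h : ∀ {e}, e ∈ letterEdges n (i + k) (true, true, true) →
      (e ∈ wordEdges n i w ↔ e ∈ letterEdges n (i + k) w[k]) :=
    mem_wordEdges_iff_of_mem hn hw hk
  simp only [readLetter, h (spoke_mem_letterEdges.2 rfl), h (outer_mem_letterEdges.2 rfl),
    h (inner_mem_letterEdges.2 rfl), spoke_mem_letterEdges, outer_mem_letterEdges,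
    inner_mem_letterEdges, Bool.decide_eq_true]

theorem readWord_length (T : Set (Sym2 (PV n))) (i : ZMod n) (k : ℕ) :
    (readWord T i k).length = k := by
  induction k generalizing i with
  | zero => rfl
  | succ k ih => simp [readWord, ih]

theorem readWord_add (T : Set (Sym2 (PV n))) (i : ZMod n) (j k : ℕ) :
    readWord T i (j + k) = readWord T i j ++ readWord T (i + j) k := by
  induction j generalizing i with
  | zero => simp [readWord]
  | succ j ih => rw [Nat.succ_add, readWord, ih, add_one_add_natCast, readWord, List.cons_append]

theorem readWord_getElem (T : Set (Sym2 (PV n))) (i : ZMod n) {j k : ℕ}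
    (h : j < (readWord T i k).length) : (readWord T i k)[j] = readLetter T (i + j) := by
  induction k generalizing i j with
  | zero => simp [readWord] at h
  | succ k ih =>
    cases j with
    | zero => simp [readWord]
    | succ j => simp only [readWord, List.getElem_cons_succ, ih, add_one_add_natCast]

theorem readWord_wordEdges (hn : 5 ≤ n) {w : List Triple} (hw : w.length = n) :
    readWord (wordEdges n 0 w) 0 n = w := by
  refine List.ext_getElem ((readWord_length _ _ _).trans hw.symm) fun k h hk => ?_
  rw [readWord_getElem, readLetter_wordEdges hn hw.le hk]

theorem mem_edgeSet_iff {e : Sym2 (PV n)} (hn : 5 ≤ n) :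
    e ∈ (petersen n).edgeSet ↔ ∃ i, e ∈ letterEdges n i (true, true, true) := by
  have h1 : (1 : ZMod n) ≠ 0 := mod_cast natCast_ne_zero (k := 1) hn (by norm_num) (by norm_num)
  have h2 : (2 : ZMod n) ≠ 0 := mod_cast natCast_ne_zero (k := 2) hn (by norm_num) (by norm_num)
  induction e with | h x y =>
  rw [SimpleGraph.mem_edgeSet, petersen, SimpleGraph.fromRel_adj]
  simp only [letterEdges, Set.mem_ofPred_eq, true_and, Sym2.eq_iff]
  constructor
  · rintro ⟨-, (⟨i, rfl, rfl⟩ | ⟨i, rfl, rfl⟩ | ⟨i, rfl, rfl⟩) |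
      (⟨i, rfl, rfl⟩ | ⟨i, rfl, rfl⟩ | ⟨i, rfl, rfl⟩)⟩ <;> exact ⟨i, by simp⟩
  · rintro ⟨i, (⟨rfl, rfl⟩ | ⟨rfl, rfl⟩) | (⟨rfl, rfl⟩ | ⟨rfl, rfl⟩) | (⟨rfl, rfl⟩ | ⟨rfl, rfl⟩)⟩ <;>
      simp [pu, pv, h1, h2]

theorem wordEdges_subset (hn : 5 ≤ n) (i : ZMod n) (w : List Triple) :
    wordEdges n i w ⊆ (petersen n).edgeSet := by
  intro e he
  obtain ⟨k, l, -, h⟩ := mem_wordEdges.1 he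
  exact (mem_edgeSet_iff hn).2 ⟨i + k, h.imp (fun h => ⟨rfl, h.2⟩)
    (Or.imp (fun h => ⟨rfl, h.2⟩) fun h => ⟨rfl, h.2⟩)⟩

theorem wordEdges_readWord (hn : 5 ≤ n) {T : Set (Sym2 (PV n))}
    (hT : T ⊆ (petersen n).edgeSet) : wordEdges n 0 (readWord T 0 n) = T := by
  have : NeZero n := ⟨by omega⟩
  have hmem : ∀ i e, e ∈ letterEdges n i (true, true, true) →
      (e ∈ letterEdges n i (readLetter T i) ↔ e ∈ T) := by
    rintro i e (⟨-, rfl⟩ | ⟨-, rfl⟩ | ⟨-, rfl⟩)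
    · simp [spoke_mem_letterEdges, readLetter]
    · simp [outer_mem_letterEdges, readLetter]
    · simp [inner_mem_letterEdges, readLetter]
  have hread : ∀ i e, e ∈ letterEdges n i (true, true, true) →
      (e ∈ wordEdges n 0 (readWord T 0 n) ↔ e ∈ T) := by
    intro i e he
    have hi : i = 0 + (i.val : ZMod n) := by simp
    rw [hi] at he
    rw [mem_wordEdges_iff_of_mem hn (readWord_length _ _ _).le
      (by rw [readWord_length]; exact ZMod.val_lt i) he, readWord_getElem, hmem _ _ he]
  ext e
  constructor <;> intro h
  · obtain ⟨i, hi⟩ := (mem_edgeSet_iff hn).1 (wordEdges_subset hn _ _ h)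
    exact (hread i e hi).1 h
  · obtain ⟨i, hi⟩ := (mem_edgeSet_iff hn).1 (hT h)
    exact (hread i e hi).2 h

theorem under_readWord {T T' : Set (Sym2 (PV n))} (h : T ⊆ T') (i : ZMod n) (k : ℕ) :
    Under (readWord T i k) (readWord T' i k) := by
  induction k generalizing i with
  | zero => exact .nil
  | succ k ih =>
    refine .cons ?_ (ih _)
    simp only [below, readLetter, Bool.and_eq_true, Bool.or_eq_true, Bool.not_eq_true',
      decide_eq_false_iff_not, decide_eq_true_eq]
    have := fun e => @h e
    exact ⟨⟨not_or_of_imp (this _), not_or_of_imp (this _)⟩, not_or_of_imp (this _)⟩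

theorem wordEdges_mono {S w : List Triple} (h : Under S w) (i : ZMod n) :
    wordEdges n i S ⊆ wordEdges n i w := by
  induction h generalizing i with
  | nil => exact subset_rfl
  | cons h _ ih =>
    refine Set.union_subset_union (fun e he => ?_) (ih _)
    simp only [below, Bool.and_eq_true, Bool.or_eq_true, Bool.not_eq_true'] at h
    simp only [letterEdges, Set.mem_ofPred_eq] at he ⊢
    grind

theorem ncard_letterEdges (i : ZMod n) (l : Triple) :
    (letterEdges n i l).ncard = weight l := by
  have h1 : s(pu i, pv i) ≠ s(pu i, pu (i + 2)) := by simp [pu, pv]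
  have h2 : s(pu i, pv i) ≠ s(pv i, pv (i + 1)) := by simp [pu, pv]
  have h3 : s(pu i, pu (i + 2)) ≠ s(pv i, pv (i + 1)) := by simp [pu, pv]
  obtain ⟨a, b, c⟩ := l
  have key : letterEdges n i (a, b, c) = (((bif a then {s(pu i, pv i)} else ∅) ∪
      ((bif b then {s(pu i, pu (i + 2))} else ∅) ∪ (bif c then {s(pv i, pv (i + 1))} else ∅)) :
      Finset (Sym2 (PV n))) : Set (Sym2 (PV n))) := by
    ext e
    cases a <;> cases b <;> cases c <;> simp [letterEdges]
    tauto
  rw [key, Set.ncard_coe_finset]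
  cases a <;> cases b <;> cases c <;> simp [weight, h1, h1.symm, h2, h3]

theorem ncard_wordEdges (hn : 5 ≤ n) (i : ZMod n) {w : List Triple} (hw : w.length ≤ n) :
    (wordEdges n i w).ncard = totalWeight w := by
  have : NeZero n := ⟨by omega⟩
  induction w generalizing i with
  | nil => simp [wordEdges, totalWeight]
  | cons l w ih =>
    rw [wordEdges, Set.ncard_union_eq, ncard_letterEdges, ih (i + 1) (Nat.le_of_succ_le hw)]
    · simp [totalWeight]
    · rw [Set.disjoint_left]
      intro e he he'
      obtain ⟨k, x, hk, hx⟩ := mem_wordEdges.1 he'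
      obtain ⟨hkw, -⟩ := List.getElem?_eq_some_iff.1 hk
      have h0 : ((k + 1 : ℕ) : ZMod n) = 0 := by
        push_cast
        linear_combination -letterEdges_index hn he hx
      rw [ZMod.natCast_eq_zero_iff] at h0
      have := Nat.le_of_dvd (Nat.succ_pos k) h0
      simp only [List.length_cons] at hw
      omega

theorem existsUnique_iff_exactlyOne {α : Type*} {P : α → Prop} {a b c : α} (hab : a ≠ b)
    (hac : a ≠ c) (hbc : b ≠ c) (h : ∀ x, P x → x = a ∨ x = b ∨ x = c) {x y z : Bool}
    (hx : x = true ↔ P a) (hy : y = true ↔ P b) (hz : z = true ↔ P c) :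
    (∃! x, P x) ↔ exactlyOne x y z = true := by
  have hiff : exactlyOne x y z = true ↔
      (P a ∧ ¬ P b ∧ ¬ P c) ∨ (¬ P a ∧ P b ∧ ¬ P c) ∨ (¬ P a ∧ ¬ P b ∧ P c) := by
    rw [← hx, ← hy, ← hz]
    cases x <;> cases y <;> cases z <;> decide
  rw [hiff]
  constructor
  · rintro ⟨w, hw, huniq⟩
    have ha := huniq a
    have hb := huniq b
    have hc := huniq c
    rcases h w hw with rfl | rfl | rfl
    · exact .inl ⟨hw, fun h => hab (hb h).symm, fun h => hac (hc h).symm⟩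
    · exact .inr (.inl ⟨fun h => hab (ha h), hw, fun h => hbc (hc h).symm⟩)
    · exact .inr (.inr ⟨fun h => hac (ha h), fun h => hbc (hb h), hw⟩)
  · rintro (⟨h1, h2, h3⟩ | ⟨h1, h2, h3⟩ | ⟨h1, h2, h3⟩)
    · exact ⟨a, h1, fun w hw => by rcases h w hw with rfl | rfl | rfl <;> tauto⟩
    · exact ⟨b, h2, fun w hw => by rcases h w hw with rfl | rfl | rfl <;> tauto⟩
    · exact ⟨c, h3, fun w hw => by rcases h w hw with rfl | rfl | rfl <;> tauto⟩

theorem existsUnique_pu_iff (hn : 5 ≤ n) {T : Set (Sym2 (PV n))}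
    (hT : T ⊆ (petersen n).edgeSet) (i : ZMod n) :
    (∃! x, s(pu i, x) ∈ T) ↔
      exactlyOne (stateAt T i).2.1 (readLetter T i).2.1 (readLetter T i).1 = true := by
  have h4 : (4 : ZMod n) ≠ 0 := mod_cast natCast_ne_zero (k := 4) hn (by norm_num) (by norm_num)
  refine existsUnique_iff_exactlyOne (a := pu (i - 2)) (b := pu (i + 2)) (c := pv i)
    ?_ ?_ ?_ ?_ ?_ ?_ ?_
  · intro h
    simp only [pu, Sum.inl.injEq] at h
    exact h4 (by linear_combination -h)
  · simp [pu, pv]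
  · simp [pu, pv]
  · intro x hx
    obtain ⟨j, h⟩ := (mem_edgeSet_iff hn).1 (hT hx)
    simp only [letterEdges, Set.mem_ofPred_eq, true_and, Sym2.eq_iff] at h
    rcases h with (⟨h, rfl⟩ | ⟨h, rfl⟩) | (⟨h, rfl⟩ | ⟨h, rfl⟩) | (⟨h, rfl⟩ | ⟨h, rfl⟩) <;>
      simp_all [pu, pv]
  · simp only [stateAt, readLetter, decide_eq_true_eq, sub_add_cancel]
    rw [Sym2.eq_swap]
  · simp [readLetter]
  · simp [readLetter]

theorem existsUnique_pv_iff (hn : 5 ≤ n) {T : Set (Sym2 (PV n))}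
    (hT : T ⊆ (petersen n).edgeSet) (i : ZMod n) :
    (∃! x, s(pv i, x) ∈ T) ↔
      exactlyOne (stateAt T i).1 (readLetter T i).1 (readLetter T i).2.2 = true := by
  have h2 : (2 : ZMod n) ≠ 0 := mod_cast natCast_ne_zero (k := 2) hn (by norm_num) (by norm_num)
  refine existsUnique_iff_exactlyOne (a := pv (i - 1)) (b := pu i) (c := pv (i + 1))
    ?_ ?_ ?_ ?_ ?_ ?_ ?_
  · simp [pu, pv]
  · intro h
    simp only [pv, Sum.inr.injEq] at h
    exact h2 (by linear_combination -h)
  · simp [pu, pv]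
  · intro x hx
    obtain ⟨j, h⟩ := (mem_edgeSet_iff hn).1 (hT hx)
    simp only [letterEdges, Set.mem_ofPred_eq, true_and, Sym2.eq_iff] at h
    rcases h with (⟨h, rfl⟩ | ⟨h, rfl⟩) | (⟨h, rfl⟩ | ⟨h, rfl⟩) | (⟨h, rfl⟩ | ⟨h, rfl⟩) <;>
      simp_all [pu, pv]
  · simp only [stateAt, readLetter, decide_eq_true_eq, sub_add_cancel]
    rw [Sym2.eq_swap]
  · simp only [readLetter, decide_eq_true_eq]
    rw [Sym2.eq_swap]
  · simp [readLetter]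

theorem forall_existsUnique_iff (hn : 5 ≤ n) {T : Set (Sym2 (PV n))}
    (hT : T ⊆ (petersen n).edgeSet) :
    (∀ v, ∃! x, s(v, x) ∈ T) ↔ ∀ i, admits (stateAt T i) (readLetter T i) = true := by
  simp only [admits, Bool.and_eq_true, ← existsUnique_pu_iff hn hT, ← existsUnique_pv_iff hn hT]
  exact ⟨fun h i => ⟨h _, h _⟩, fun h v => by cases v with
    | inl i => exact (h i).1
    | inr i => exact (h i).2⟩

theorem next_stateAt (T : Set (Sym2 (PV n))) (i : ZMod n) :
    next (stateAt T i) (readLetter T i) = stateAt T (i + 1) := by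
  simp only [next, stateAt]
  rw [show i + 1 - 1 = i by ring, show i + 1 - 2 = i - 1 by ring]

theorem run_readWord {T : Set (Sym2 (PV n))}
    (h : ∀ i, admits (stateAt T i) (readLetter T i) = true) (i : ZMod n) (k : ℕ) :
    Run (stateAt T i) (readWord T i k) (stateAt T (i + k)) := by
  induction k generalizing i with
  | zero => simp [readWord, Run]
  | succ k ih =>
    refine ⟨h i, ?_⟩
    rw [next_stateAt]
    simpa only [add_one_add_natCast] using ih (i + 1)

theorem admits_of_run_readWord {T : Set (Sym2 (PV n))} {i : ZMod n} {j k : ℕ} {a b : Triple}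
    (h : Run a (readWord T i (j + 3 + k)) b) :
    admits (stateAt T (i + j + 2)) (readLetter T (i + j + 2)) = true := by
  induction j generalizing i a with
  | zero =>
    rw [readWord_add] at h
    obtain ⟨c, ⟨-, -, h, -⟩, -⟩ := run_append.1 h
    rw [add_assoc i 1 1, one_add_one_eq_two] at h
    convert h using 2
    · simp only [stateAt, next, Nat.cast_zero, add_zero]
      rw [show i + 2 - 1 = i + 1 by ring, show i + 2 - 2 = i by ring]
    · simp
  | succ j ih =>
    rw [show j + 1 + 3 + k = j + 3 + k + 1 by omega] at h
    have := ih h.2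
    rwa [add_one_add_natCast] at this

theorem forall_admits_iff (hn : 5 ≤ n) (T : Set (Sym2 (PV n))) :
    (∀ i, admits (stateAt T i) (readLetter T i) = true) ↔ ∃ q, Run q (readWord T 0 n) q := by
  have : NeZero n := ⟨by omega⟩
  constructor
  · intro h
    exact ⟨stateAt T 0, by simpa using run_readWord h 0 n⟩
  · rintro ⟨q, hq⟩ i
    have h2 : Run q (readWord T 0 (n + n)) q := by
      rw [readWord_add]
      exact run_append.2 ⟨q, hq, by simpa using hq⟩
    have hlt := ZMod.val_lt (i - 2)
    obtain ⟨k, hk⟩ : ∃ k, n + n = (i - 2).val + 3 + k := ⟨n + n - ((i - 2).val + 3), by omega⟩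
    rw [hk] at h2
    simpa using admits_of_run_readWord h2

theorem isPerfectMatching_iff_run (hn : 5 ≤ n) {N : (petersen n).Subgraph} :
    N.IsPerfectMatching ↔ ∃ q, Run q (readWord N.edgeSet 0 n) q := by
  rw [← forall_admits_iff hn, ← forall_existsUnique_iff hn N.edgeSet_subset,
    SimpleGraph.Subgraph.isPerfectMatching_iff]
  rfl

theorem exists_isPerfectMatching (hn : 5 ≤ n) {w : List Triple} (hw : w.length = n) {q : Triple}
    (hq : Run q w q) :
    ∃ N : (petersen n).Subgraph, N.IsPerfectMatching ∧ N.edgeSet = wordEdges n 0 w := by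
  let N : (petersen n).Subgraph :=
    { verts := Set.univ
      Adj := fun x y => s(x, y) ∈ wordEdges n 0 w
      adj_sub := fun h => wordEdges_subset hn 0 w h
      edge_vert := fun _ => Set.mem_univ _
      symm := ⟨fun x y h => by rwa [Sym2.eq_swap]⟩ }
  have hE : N.edgeSet = wordEdges n 0 w := by
    ext e
    induction e with | h x y => exact Iff.rfl
  refine ⟨N, (isPerfectMatching_iff_run hn).2 ⟨q, ?_⟩, hE⟩
  rwa [hE, readWord_wordEdges hn hw]

theorem eq_of_edgeSet_eq {V : Type*} {G : SimpleGraph V} {M N : G.Subgraph}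
    (hM : M.IsPerfectMatching) (hN : N.IsPerfectMatching) (h : M.edgeSet = N.edgeSet) : M = N := by
  refine SimpleGraph.Subgraph.ext
    ((SimpleGraph.Subgraph.isSpanning_iff.1 hM.2).trans
      (SimpleGraph.Subgraph.isSpanning_iff.1 hN.2).symm) ?_
  ext x y
  rw [← SimpleGraph.Subgraph.mem_edgeSet, h, SimpleGraph.Subgraph.mem_edgeSet]

theorem Forces.of_isForcingSet (hn : 5 ≤ n) {M : (petersen n).Subgraph} {m : List Triple}
    (hm : m.length = n) (hE : M.edgeSet = wordEdges n 0 m) {S : Set (Sym2 (PV n))}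
    (hS : IsForcingSet (petersen n) M S) :
    ∃ s, Forces m s ∧ totalWeight s = S.ncard := by
  have hSG := hS.1.trans M.edgeSet_subset
  refine ⟨readWord S 0 n, ⟨?_, fun w q hw hq => ?_⟩, ?_⟩
  · have := under_readWord hS.1 0 n
    rwa [hE, readWord_wordEdges hn hm] at this
  · have hwn : w.length = n := hw.length_eq.symm.trans (readWord_length _ _ _)
    obtain ⟨N, hN, hNE⟩ := exists_isPerfectMatching hn hwn hq
    have hsub := wordEdges_mono hw (0 : ZMod n)
    rw [wordEdges_readWord hn hSG, ← hNE] at hsub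
    rw [← readWord_wordEdges hn hwn, ← hNE, hS.2 N hN hsub, hE, readWord_wordEdges hn hm]
  · rw [← ncard_wordEdges hn 0 (readWord_length _ _ _).le, wordEdges_readWord hn hSG]

theorem Forces.isForcingSet (hn : 5 ≤ n) {M : (petersen n).Subgraph} (hM : M.IsPerfectMatching)
    {m : List Triple} (hm : m.length = n) (hE : M.edgeSet = wordEdges n 0 m) {s : List Triple}
    (hs : Forces m s) : IsForcingSet (petersen n) M (wordEdges n 0 s) := by
  refine ⟨hE ▸ wordEdges_mono hs.1 0, fun N hN hsub => eq_of_edgeSet_eq hN hM ?_⟩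
  obtain ⟨q, hq⟩ := (isPerfectMatching_iff_run hn).1 hN
  have := under_readWord hsub 0 n
  rw [readWord_wordEdges hn (hs.1.length_eq.trans hm)] at this
  rw [hE, ← hs.2 _ q this hq, wordEdges_readWord hn N.edgeSet_subset]

theorem exists_isForcingSet (hn : 5 ≤ n) {M M' : (petersen n).Subgraph}
    (hM' : M'.IsPerfectMatching) {m m' : List Triple} (hm : m.length = n) (hm' : m'.length = n)
    (hE : M.edgeSet = wordEdges n 0 m) (hE' : M'.edgeSet = wordEdges n 0 m')
    (h : ∀ s, Forces m s → ∃ s', Forces m' s' ∧ totalWeight s' ≤ totalWeight s + 1)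
    (S : Set (Sym2 (PV n))) (hS : IsForcingSet (petersen n) M S) :
    ∃ S', IsForcingSet (petersen n) M' S' ∧ S'.ncard ≤ S.ncard + 1 := by
  obtain ⟨s, hs, hwt⟩ := Forces.of_isForcingSet hn hm hE hS
  obtain ⟨s', hs', hle⟩ := h s hs
  refine ⟨_, hs'.isForcingSet hn hM' hm' hE', ?_⟩
  rwa [ncard_wordEdges hn 0 (hs'.1.length_eq.trans hm').le, ← hwt]

theorem forcingNumber_le_add_one {V : Type*} {G : SimpleGraph V} {M M' : G.Subgraph}
    (h : ∀ S, IsForcingSet G M S → ∃ S', IsForcingSet G M' S' ∧ S'.ncard ≤ S.ncard + 1)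
    (h' : ∀ S, IsForcingSet G M' S → ∃ S', IsForcingSet G M S' ∧ S'.ncard ≤ S.ncard + 1) :
    forcingNumber G M' ≤ forcingNumber G M + 1 := by
  rcases Set.eq_empty_or_nonempty {k | ∃ S, IsForcingSet G M S ∧ S.ncard = k} with he | hne
  · have : {k | ∃ S, IsForcingSet G M' S ∧ S.ncard = k} = ∅ := by
      rw [Set.eq_empty_iff_forall_notMem] at he ⊢
      rintro k ⟨S, hS, -⟩
      obtain ⟨S', hS', -⟩ := h' S hS
      exact he _ ⟨S', hS', rfl⟩
    simp [forcingNumber, this]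
  · obtain ⟨S, hS, hk⟩ := Nat.sInf_mem hne
    obtain ⟨S', hS', hle⟩ := h S hS
    have hmem : S'.ncard ∈ {k | ∃ S, IsForcingSet G M' S ∧ S.ncard = k} := ⟨S', hS', rfl⟩
    refine (Nat.sInf_le hmem).trans (hle.trans ?_)
    rw [hk, forcingNumber]

theorem length_word_replicate (d c : ℕ) :
    (word (List.replicate d false ++ List.replicate c true)).length = 4 * d + 3 * c := by
  simp [word, wordC, wordD, mul_comm]

end PetersenWord

open PetersenWord

/-- for `n ≥ 37`, the forcing numbers of the type-2 perfect matchings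
`D^d C^c` and `D^{d+3} C^{c-4}` of `P(n,2)` differ by at most one. -/
theorem DC_power_transform_forcing (n d c : ℕ) (hn : 37 ≤ n) (hc : 4 ≤ c)
    (hsum : 4 * d + 3 * c = n)
    (M3 M4 : (petersen n).Subgraph)
    (hM3 : M3.IsPerfectMatching)
    (hE3 : M3.edgeSet = cdEdges n 0 (List.replicate d false ++ List.replicate c true))
    (hM4 : M4.IsPerfectMatching)
    (hE4 : M4.edgeSet =
      cdEdges n 0 (List.replicate (d + 3) false ++ List.replicate (c - 4) true)) :
    |(forcingNumber (petersen n) M3 : ℤ) - (forcingNumber (petersen n) M4 : ℤ)| ≤ 1 := by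
  have hn5 : 5 ≤ n := by omega
  rw [cdEdges_eq_wordEdges] at hE3 hE4
  have hl3 := (length_word_replicate d c).trans hsum
  have hl4 : (word (List.replicate (d + 3) false ++ List.replicate (c - 4) true)).length = n := by
    rw [length_word_replicate]
    omega
  have forward := exists_isForcingSet hn5 hM4 hl3 hl4 hE3 hE4 fun s hs =>
    hs.replicate_forward hc (by omega)
  have backward := exists_isForcingSet hn5 hM3 hl4 hl3 hE4 hE3 fun s hs =>
    hs.replicate_backward hc
  have h1 := forcingNumber_le_add_one forward backward
  have h2 := forcingNumber_le_add_one backward forward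
  rw [abs_le]
  constructor <;> omega
end

section
/- Let n ≥ 37, d ≥ 0 and c ≥ 0 with 4d + 3c = n, and let D^d C^c be the type-2 perfect matching of P(n,2) consisting of d consecutive blocks D followed by c consecutive blocks C. Then f(P(n,2), D^d C^c) = ⌈(6d + 3c + η(d))/12⌉ + ξ(d,c), where η(d) = 9 if d is even and η(d) = 12 if d is odd, and ξ(d,c) = 1 if either (d = 0 and c ≡ 1 (mod 4)) or (d = 1 and c ≡ 2 (mod 4)), and ξ(d,c) = 0 otherwise. -/
open SimpleGraph

/-! ### Boolean matrices encoded by row masks -/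

/-- The entry `(x, y)` of the Boolean matrix whose rows are the bit masks in `A`. -/
def ent (A : List ℕ) (x y : ℕ) : Bool := (A.getD x 0).testBit y

/-- Boolean product of a row mask with a matrix. -/
def rowMul : ℕ → List ℕ → ℕ
  | _, [] => 0
  | r, b :: B => (if r % 2 = 1 then b else 0) ||| rowMul (r / 2) B

/-- Boolean matrix product. -/
def matMul (A B : List ℕ) : List ℕ := A.map (fun r => rowMul r B)

/-- The identity matrix of size `9`. -/
def matOne : List ℕ := [1, 2, 4, 8, 16, 32, 64, 128, 256]

/-- Entrywise comparison of matrices. -/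
def matLe : List ℕ → List ℕ → Bool
  | [], _ => true
  | a :: A, [] => (a == 0) && matLe A []
  | a :: A, b :: B => (a &&& b == a) && matLe A B

theorem testBit_rowMul (r : ℕ) (B : List ℕ) (y : ℕ) :
    (rowMul r B).testBit y = true ↔ ∃ z, r.testBit z = true ∧ ent B z y = true := by
  induction B generalizing r with
  | nil => simp [rowMul, ent]
  | cons b B ih =>
    rw [rowMul, Nat.testBit_or, Bool.or_eq_true, ih]
    constructor
    · rintro (h | ⟨z, hz, h⟩)
      · refine ⟨0, ?_, ?_⟩
        · by_cases hr : r % 2 = 1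
          · simp [Nat.testBit_zero, hr]
          · simp [hr] at h
        · by_cases hr : r % 2 = 1
          · simpa [ent, hr] using h
          · simp [hr] at h
      · exact ⟨z + 1, by rw [Nat.testBit_succ]; exact hz, by simpa [ent] using h⟩
    · rintro ⟨z, hz, h⟩
      cases z with
      | zero =>
        left
        have hr : r % 2 = 1 := by simpa [Nat.testBit_zero] using hz
        simpa [ent, hr] using h
      | succ z =>
        right
        exact ⟨z, by rw [← Nat.testBit_succ]; exact hz, by simpa [ent] using h⟩

theorem ent_matMul (A B : List ℕ) (x y : ℕ) :
    ent (matMul A B) x y = true ↔ ∃ z, ent A x z = true ∧ ent B z y = true := by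
  have h : (matMul A B).getD x 0 = rowMul (A.getD x 0) B := by
    have h0 : rowMul 0 B = 0 := by
      induction B with
      | nil => rfl
      | cons b B ih => simp [rowMul, ih]
    unfold matMul
    by_cases hx : x < A.length
    · simp [List.getD, hx]
    · simp [List.getD, Nat.le_of_not_lt hx, h0]
  rw [ent, h, testBit_rowMul]
  rfl

theorem matLe_spec {A B : List ℕ} (h : matLe A B = true) (x y : ℕ)
    (hA : ent A x y = true) : ent B x y = true := by
  induction A generalizing B x with
  | nil => simp [ent] at hA
  | cons a A ih =>
    cases B with
    | nil =>
      simp only [matLe, Bool.and_eq_true, beq_iff_eq] at h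
      cases x with
      | zero => simp [ent, h.1] at hA
      | succ x =>
        have := ih h.2 x (by simpa [ent] using hA)
        simp [ent] at this
    | cons b B =>
      simp only [matLe, Bool.and_eq_true, beq_iff_eq] at h
      cases x with
      | zero =>
        have h1 := congrArg (fun m => Nat.testBit m y) h.1
        simp only [ent, List.getD_cons_zero] at hA ⊢
        simp only [Nat.testBit_and, hA, Bool.true_and] at h1
        exact h1
      | succ x => simpa [ent] using ih h.2 x (by simpa [ent] using hA)

theorem ent_matOne (x y : ℕ) : ent matOne x y = true ↔ x = y ∧ x < 9 := by
  by_cases hx : x < 9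
  · have h : ∀ k : ℕ, k < 9 → matOne.getD k 0 = 2 ^ k := by decide
    rw [ent, h x hx, Nat.testBit_two_pow]
    simp [hx]
  · have : matOne.length ≤ x := by simpa [matOne] using hx
    simp [ent, List.getD, this, hx]

/-- The matrix `A` is entrywise below `B`. -/
def MatSub (A B : List ℕ) : Prop := ∀ x y, ent A x y = true → ent B x y = true

theorem MatSub.matMul {A A' B B' : List ℕ} (hA : MatSub A A') (hB : MatSub B B') :
    MatSub (matMul A B) (matMul A' B') := by
  intro x y h
  obtain ⟨z, h1, h2⟩ := (ent_matMul _ _ _ _).1 h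
  exact (ent_matMul _ _ _ _).2 ⟨z, hA _ _ h1, hB _ _ h2⟩

/-! ### Transitions -/

/-- A position of the matching under study: the state before it, the state after it, and
whether its spoke, its outer edge and its inner edge are prescribed. -/
abbrev Letter := ℕ × ℕ × Bool × Bool × Bool

/-- Number of prescribed edges at a position. -/
def letterCost (l : Letter) : ℕ := l.2.2.1.toNat + l.2.2.2.1.toNat + l.2.2.2.2.toNat

/-- Admissible pairs of consecutive states of a perfect matching of `P(n,2)`. The bits `2, 1, 0`
of the state at `i` tell whether `u_{i-2}u_i`, `u_{i-1}u_{i+1}`, `v_{i-1}v_i` are used. -/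
def stepOk (x y : ℕ) : Bool :=
  (y.testBit 2 == x.testBit 1) && !(x.testBit 2 && y.testBit 1) &&
    !(x.testBit 0 && y.testBit 0) &&
    ((x.testBit 2 || y.testBit 1) == (x.testBit 0 || y.testBit 0))

/-- Whether the spoke (`t = 0`), the outer edge (`t = 1`) or the inner edge (`t = 2`) of a
position is used when the states around it are `x` and `y`. -/
def lab (t : Fin 3) (x y : ℕ) : Bool :=
  match t with
  | 0 => !x.testBit 2 && !y.testBit 1
  | 1 => y.testBit 1
  | 2 => y.testBit 0

/-- Admissible transitions that use all prescribed edges. -/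
def letterOk (l : Letter) (x y : ℕ) : Bool :=
  stepOk x y && (!l.2.2.1 || lab 0 x y) && (!l.2.2.2.1 || lab 1 x y) &&
    (!l.2.2.2.2 || lab 2 x y)

/-- Transitions between the nine states: `8` stands for not having left the given matching yet,
`x < 8` for being in state `x` after having left it. -/
def transOk (l : Letter) (x y : ℕ) : Bool :=
  (decide (y < 8) && ((decide (x < 8) && letterOk l x y) ||
    (x == 8 && letterOk l l.1 y && y != l.2.1))) || (x == 8 && y == 8)

/-- The mask of the indices below `k` at which `f` holds. -/
def maskOf (f : ℕ → Bool) : ℕ → ℕ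
  | 0 => 0
  | k + 1 => maskOf f k ||| (if f k then 2 ^ k else 0)

theorem testBit_maskOf (f : ℕ → Bool) (k y : ℕ) :
    (maskOf f k).testBit y = true ↔ y < k ∧ f y = true := by
  induction k with
  | zero => simp [maskOf]
  | succ k ih =>
    rw [maskOf, Nat.testBit_or, Bool.or_eq_true, ih]
    by_cases hk : f k = true
    · rw [if_pos hk, Nat.testBit_two_pow, decide_eq_true_eq]
      constructor
      · rintro (h | rfl)
        · exact ⟨by omega, h.2⟩
        · exact ⟨by omega, hk⟩
      · rintro ⟨h, hf⟩
        by_cases hy : y = k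
        · exact Or.inr hy.symm
        · exact Or.inl ⟨by omega, hf⟩
    · rw [if_neg hk]
      constructor
      · rintro (h | h)
        · exact ⟨by omega, h.2⟩
        · simp at h
      · rintro ⟨h, hf⟩
        refine Or.inl ⟨?_, hf⟩
        rcases Nat.lt_succ_iff_lt_or_eq.1 h with h | rfl
        · exact h
        · exact absurd hf hk

/-- Transition matrix of a position. -/
def letterMat (l : Letter) : List ℕ := (List.range 9).map (fun x => maskOf (transOk l x) 9)

theorem transOk_lt {l : Letter} {x y : ℕ} (h : transOk l x y = true) : x < 9 ∧ y < 9 := by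
  simp only [transOk, Bool.or_eq_true, Bool.and_eq_true, decide_eq_true_eq, beq_iff_eq] at h
  omega

theorem ent_letterMat (l : Letter) (x y : ℕ) :
    ent (letterMat l) x y = true ↔ transOk l x y = true := by
  by_cases hx : x < 9
  · have : (letterMat l).getD x 0 = maskOf (transOk l x) 9 := by
      simp [letterMat, List.getD, hx]
    rw [ent, this, testBit_maskOf]
    exact ⟨fun h => h.2, fun h => ⟨(transOk_lt h).2, h⟩⟩
  · have : (letterMat l).getD x 0 = 0 := by
      simp [letterMat, List.getD, Nat.le_of_not_lt hx]
    rw [ent, this]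
    constructor
    · simp
    · exact fun h => absurd (transOk_lt h).1 hx

/-- Transition matrix of a word. -/
def wordMat : List Letter → List ℕ
  | [] => matOne
  | l :: L => matMul (letterMat l) (wordMat L)

theorem ent_lt_of_wordMat {L : List Letter} {x y : ℕ} (h : ent (wordMat L) x y = true) :
    x < 9 := by
  cases L with
  | nil => exact ((ent_matOne _ _).1 h).2
  | cons l L =>
    obtain ⟨z, h1, -⟩ := (ent_matMul _ _ _ _).1 h
    exact (transOk_lt ((ent_letterMat _ _ _).1 h1)).1

theorem ent_wordMat_append (L L' : List Letter) (x y : ℕ) :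
    ent (wordMat (L ++ L')) x y = true ↔
      ent (matMul (wordMat L) (wordMat L')) x y = true := by
  induction L generalizing x with
  | nil =>
    rw [ent_matMul]
    constructor
    · intro h
      exact ⟨x, (ent_matOne _ _).2 ⟨rfl, ent_lt_of_wordMat h⟩, h⟩
    · rintro ⟨z, h1, h2⟩
      obtain ⟨rfl, -⟩ := (ent_matOne _ _).1 h1
      exact h2
  | cons l L ih =>
    rw [List.cons_append, wordMat, ent_matMul, ent_matMul]
    constructor
    · rintro ⟨z, h1, h2⟩
      obtain ⟨w, h3, h4⟩ := (ent_matMul _ _ _ _).1 ((ih z).1 h2)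
      exact ⟨w, (ent_matMul _ _ _ _).2 ⟨z, h1, h3⟩, h4⟩
    · rintro ⟨w, h1, h4⟩
      obtain ⟨z, h2, h3⟩ := (ent_matMul _ _ _ _).1 h1
      exact ⟨z, h2, (ih z).2 ((ent_matMul _ _ _ _).2 ⟨w, h3, h4⟩)⟩

theorem matSub_append (L L' : List Letter) :
    MatSub (matMul (wordMat L) (wordMat L')) (wordMat (L ++ L')) :=
  fun x y h => (ent_wordMat_append L L' x y).2 h

theorem append_matSub (L L' : List Letter) :
    MatSub (wordMat (L ++ L')) (matMul (wordMat L) (wordMat L')) :=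
  fun x y h => (ent_wordMat_append L L' x y).1 h

/-- The entries of a word matrix describe walks along the word. -/
theorem ent_wordMat_range (f : ℕ → Letter) (n x y : ℕ) :
    ent (wordMat ((List.range n).map f)) x y = true ↔
      ∃ σ : ℕ → ℕ, σ 0 = x ∧ σ n = y ∧ x < 9 ∧
        ∀ i < n, transOk (f i) (σ i) (σ (i + 1)) = true := by
  induction n generalizing y with
  | zero =>
    rw [List.range_zero, List.map_nil, wordMat, ent_matOne]
    constructor
    · rintro ⟨rfl, h⟩
      exact ⟨fun _ => x, rfl, rfl, h, by simp⟩
    · rintro ⟨σ, rfl, rfl, h, -⟩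
      exact ⟨rfl, h⟩
  | succ n ih =>
    rw [List.range_succ, List.map_append, ent_wordMat_append, ent_matMul]
    have hl : ∀ z, ent (wordMat ([n].map f)) z y = true ↔ transOk (f n) z y = true := by
      intro z
      rw [List.map_singleton, wordMat, wordMat, ent_matMul]
      constructor
      · rintro ⟨w, h1, h2⟩
        obtain ⟨rfl, -⟩ := (ent_matOne _ _).1 h2
        exact (ent_letterMat _ _ _).1 h1
      · intro h
        exact ⟨y, (ent_letterMat _ _ _).2 h, (ent_matOne _ _).2 ⟨rfl, (transOk_lt h).2⟩⟩
    constructor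
    · rintro ⟨z, h1, h2⟩
      obtain ⟨σ, h0, hn, hx, hσ⟩ := (ih z).1 h1
      refine ⟨fun i => if i ≤ n then σ i else y, by simpa using h0, by simp, hx, ?_⟩
      intro i hi
      rcases Nat.lt_succ_iff_lt_or_eq.1 hi with h | rfl
      · have h3 : i ≤ n := by omega
        have h4 : i + 1 ≤ n := by omega
        simpa [h3, h4] using hσ i h
      · simpa [hn] using (hl z).1 h2
    · rintro ⟨σ, h0, hn, hx, hσ⟩
      exact ⟨σ n, (ih _).2 ⟨σ, h0, rfl, hx, fun i hi => hσ i (by omega)⟩,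
        (hl _).2 (hn ▸ hσ n (by omega))⟩

/-! ### Words of blocks -/

/-- A block `C` with prescribed edges. -/
def lettersC (p q r : Bool) : List Letter :=
  [(1, 2, false, p, false), (2, 4, q, false, false), (4, 1, false, false, r)]

/-- A block `D` with prescribed edges. -/
def lettersD (p q r s : Bool) : List Letter :=
  [(1, 2, false, p, false), (2, 7, false, q, r), (7, 4, false, false, false),
    (4, 1, false, false, s)]

/-- All blocks `C` with prescribed edges. -/
def choicesC : List (List Letter) :=
  [false, true].flatMap fun p => [false, true].flatMap fun q => [false, true].map fun r =>
    lettersC p q r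

/-- All blocks `D` with prescribed edges. -/
def choicesD : List (List Letter) :=
  [false, true].flatMap fun p => [false, true].flatMap fun q => [false, true].flatMap fun r =>
    [false, true].map fun s => lettersD p q r s

/-- Number of prescribed edges in a word. -/
def wordCost (L : List Letter) : ℕ := (L.map letterCost).sum

/-- Transition matrices and costs of the blocks in `choicesC`. -/
def matsC : List (List ℕ × ℕ) := [
    ([105, 18, 6, 1, 144, 73, 9, 4, 272], 0), ([40, 2, 2, 0, 128, 8, 8, 0, 256], 1),
    ([9, 2, 0, 0, 0, 9, 0, 0, 256], 1), ([8, 2, 0, 0, 0, 8, 0, 0, 256], 2),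
    ([32, 18, 2, 1, 0, 0, 0, 0, 272], 1), ([32, 2, 2, 0, 0, 0, 0, 0, 256], 2),
    ([0, 2, 0, 0, 0, 0, 0, 0, 256], 2), ([0, 2, 0, 0, 0, 0, 0, 0, 256], 3)]

/-- Transition matrices and costs of the blocks in `choicesD`. -/
def matsD : List (List ℕ × ℕ) := [
    ([105, 6, 148, 9, 18, 105, 73, 144, 260], 0), ([40, 2, 128, 8, 2, 40, 8, 128, 256], 1),
    ([32, 2, 144, 9, 0, 32, 0, 144, 256], 1), ([32, 2, 128, 8, 0, 32, 0, 128, 256], 2),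
    ([33, 2, 0, 0, 18, 32, 0, 0, 256], 1), ([32, 2, 0, 0, 2, 32, 0, 0, 256], 2),
    ([32, 2, 0, 0, 0, 32, 0, 0, 256], 2), ([32, 2, 0, 0, 0, 32, 0, 0, 256], 3),
    ([1, 6, 4, 9, 0, 0, 0, 0, 260], 1), ([0, 2, 0, 8, 0, 0, 0, 0, 256], 2),
    ([0, 2, 0, 9, 0, 0, 0, 0, 256], 2), ([0, 2, 0, 8, 0, 0, 0, 0, 256], 3),
    ([1, 2, 0, 0, 0, 0, 0, 0, 256], 2), ([0, 2, 0, 0, 0, 0, 0, 0, 256], 3),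
    ([0, 2, 0, 0, 0, 0, 0, 0, 256], 3), ([0, 2, 0, 0, 0, 0, 0, 0, 256], 4)]

/-- Matrices that bound the words of `C` blocks from below, with their ranks shifted by `3`. -/
def tableC : List (ℕ × List ℕ) := [
    (0, [105, 150, 150, 105, 150, 105, 105, 22, 404]),
    (1, [105, 146, 22, 105, 148, 105, 105, 6, 400]),
    (1, [105, 146, 146, 105, 146, 105, 105, 146, 400]),
    (1, [105, 150, 150, 105, 0, 105, 105, 150, 404]), (2, [105, 18, 6, 1, 144, 73, 9, 4, 272]),
    (2, [105, 18, 18, 105, 18, 105, 105, 18, 272]),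
    (2, [105, 146, 146, 105, 0, 105, 105, 146, 400]),
    (2, [105, 150, 150, 105, 0, 105, 105, 0, 404]), (3, [1, 2, 4, 8, 16, 32, 64, 128, 256]),
    (3, [9, 2, 2, 9, 2, 9, 9, 2, 256]), (3, [105, 150, 0, 0, 0, 105, 0, 0, 404]),
    (3, [105, 18, 18, 105, 0, 105, 105, 18, 272]), (3, [105, 146, 146, 105, 0, 105, 105, 0, 400]),
    (4, [9, 2, 2, 9, 0, 9, 9, 2, 256]), (4, [105, 146, 0, 0, 0, 105, 0, 0, 400]),
    (4, [40, 130, 130, 40, 130, 40, 40, 2, 384]), (4, [33, 18, 18, 33, 2, 33, 33, 18, 272]),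
    (4, [105, 150, 146, 105, 0, 0, 0, 0, 404]), (4, [105, 18, 18, 105, 0, 105, 105, 0, 272]),
    (4, [0, 150, 150, 0, 150, 0, 0, 150, 404]), (5, [9, 2, 2, 9, 0, 9, 9, 0, 256]),
    (5, [73, 18, 18, 0, 4, 1, 1, 0, 272]), (5, [105, 18, 0, 0, 0, 105, 0, 0, 272]),
    (5, [33, 18, 18, 32, 0, 33, 33, 2, 272]), (5, [40, 130, 2, 40, 128, 40, 40, 2, 384]),
    (5, [73, 146, 18, 105, 0, 0, 0, 0, 400]), (5, [0, 146, 146, 0, 146, 0, 0, 146, 400]),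
    (5, [40, 130, 130, 40, 0, 40, 40, 130, 384]), (5, [0, 150, 150, 0, 0, 0, 0, 150, 404]),
    (6, [9, 2, 0, 0, 0, 9, 0, 0, 256]), (6, [32, 18, 2, 1, 0, 0, 0, 0, 272]),
    (6, [40, 2, 2, 0, 128, 8, 8, 0, 256]), (6, [0, 18, 18, 0, 18, 0, 0, 18, 272]),
    (6, [0, 150, 150, 0, 0, 0, 0, 0, 404]), (6, [0, 146, 146, 0, 0, 0, 0, 146, 400]),
    (6, [40, 2, 2, 40, 2, 40, 40, 2, 256]), (6, [40, 130, 130, 40, 0, 40, 40, 0, 384]),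
    (7, [0, 2, 2, 0, 2, 0, 0, 2, 256]), (7, [9, 2, 2, 9, 0, 0, 0, 0, 256]),
    (7, [33, 18, 0, 0, 0, 33, 0, 0, 272]), (7, [0, 150, 0, 0, 0, 0, 0, 0, 404]),
    (7, [40, 130, 0, 0, 0, 40, 0, 0, 384]), (7, [0, 18, 18, 0, 0, 0, 0, 18, 272]),
    (7, [0, 146, 146, 0, 0, 0, 0, 0, 400]), (7, [40, 2, 2, 40, 0, 40, 40, 2, 256]),
    (8, [0, 2, 2, 0, 0, 0, 0, 2, 256]), (8, [0, 18, 18, 0, 0, 0, 0, 0, 272]),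
    (8, [0, 146, 0, 0, 0, 0, 0, 0, 400]), (8, [40, 130, 130, 40, 0, 0, 0, 0, 384]),
    (8, [40, 2, 2, 40, 0, 40, 40, 0, 256]), (9, [0, 2, 2, 0, 0, 0, 0, 0, 256]),
    (9, [0, 18, 0, 0, 0, 0, 0, 0, 272]), (9, [40, 2, 0, 0, 0, 40, 0, 0, 256]),
    (10, [0, 2, 0, 0, 0, 0, 0, 0, 256])]

/-- Matrices that bound the words of `D` blocks from below, with their ranks shifted by `2`. -/
def tableD : List (ℕ × List ℕ) := [
    (0, [105, 150, 150, 105, 22, 105, 105, 146, 404]),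
    (1, [105, 6, 148, 9, 18, 105, 73, 144, 260]), (1, [9, 6, 6, 9, 6, 9, 9, 6, 260]),
    (1, [105, 150, 0, 0, 150, 105, 0, 0, 404]), (1, [41, 146, 146, 41, 146, 41, 41, 146, 400]),
    (1, [105, 150, 150, 105, 0, 105, 0, 150, 404]), (2, [1, 2, 4, 8, 16, 32, 64, 128, 256]),
    (2, [40, 130, 130, 40, 2, 40, 40, 130, 384]), (2, [105, 6, 146, 105, 0, 105, 0, 146, 260]),
    (2, [41, 146, 144, 41, 2, 41, 41, 144, 400]), (2, [9, 6, 0, 0, 6, 9, 0, 0, 260]),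
    (2, [33, 2, 2, 33, 2, 33, 33, 2, 256]), (2, [9, 6, 6, 9, 0, 9, 0, 6, 260]),
    (2, [41, 146, 0, 0, 146, 41, 0, 0, 400]), (2, [105, 150, 0, 105, 0, 0, 0, 0, 404]),
    (2, [41, 146, 146, 41, 0, 41, 0, 146, 400]), (2, [0, 150, 150, 0, 150, 0, 0, 150, 404]),
    (3, [33, 2, 0, 0, 18, 32, 0, 0, 256]), (3, [1, 6, 4, 9, 0, 0, 0, 0, 260]),
    (3, [32, 2, 144, 9, 0, 32, 0, 144, 256]), (3, [40, 2, 128, 8, 2, 40, 8, 128, 256]),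
    (3, [8, 2, 2, 8, 2, 8, 8, 2, 256]), (3, [32, 2, 2, 32, 2, 32, 32, 2, 256]),
    (3, [1, 2, 2, 1, 2, 1, 1, 2, 256]), (3, [40, 130, 0, 0, 130, 40, 0, 0, 384]),
    (3, [9, 6, 0, 0, 6, 9, 0, 0, 260]), (3, [0, 150, 0, 105, 0, 0, 0, 0, 404]),
    (3, [105, 150, 0, 0, 0, 0, 0, 0, 404]), (3, [40, 130, 130, 40, 0, 40, 0, 130, 384]),
    (3, [33, 2, 0, 0, 2, 33, 0, 0, 256]), (3, [9, 6, 0, 9, 0, 0, 0, 0, 260]),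
    (3, [33, 2, 2, 33, 0, 33, 0, 2, 256]), (3, [0, 6, 6, 0, 6, 0, 0, 6, 260]),
    (3, [0, 150, 0, 0, 150, 0, 0, 0, 404]), (3, [41, 146, 0, 41, 0, 0, 0, 0, 400]),
    (3, [0, 146, 146, 0, 146, 0, 0, 146, 400]), (3, [0, 150, 150, 0, 0, 0, 0, 150, 404]),
    (4, [32, 2, 0, 0, 2, 32, 0, 0, 256]), (4, [33, 2, 0, 33, 0, 0, 0, 0, 256]),
    (4, [0, 6, 0, 9, 0, 0, 0, 0, 260]), (4, [32, 2, 144, 41, 0, 32, 0, 144, 256]),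
    (4, [1, 2, 0, 0, 2, 1, 0, 0, 256]), (4, [0, 2, 2, 0, 2, 0, 0, 2, 256]),
    (4, [8, 2, 0, 0, 2, 8, 0, 0, 256]), (4, [9, 6, 0, 0, 0, 0, 0, 0, 260]),
    (4, [0, 6, 0, 0, 6, 0, 0, 0, 260]), (4, [32, 2, 2, 32, 0, 32, 0, 2, 256]),
    (4, [8, 2, 2, 8, 0, 8, 0, 2, 256]), (4, [1, 2, 2, 1, 0, 1, 0, 2, 256]),
    (4, [40, 130, 0, 40, 0, 0, 0, 0, 384]), (4, [0, 150, 0, 0, 0, 0, 0, 0, 404]),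
    (4, [0, 146, 0, 41, 0, 0, 0, 0, 400]), (4, [41, 146, 0, 0, 0, 0, 0, 0, 400]),
    (4, [0, 6, 6, 0, 0, 0, 0, 6, 260]), (4, [0, 146, 0, 0, 146, 0, 0, 0, 400]),
    (4, [0, 146, 146, 0, 0, 0, 0, 146, 400]), (5, [0, 2, 0, 8, 0, 0, 0, 0, 256]),
    (5, [1, 2, 0, 0, 0, 0, 0, 0, 256]), (5, [32, 2, 0, 0, 0, 32, 0, 0, 256]),
    (5, [0, 2, 0, 0, 2, 0, 0, 0, 256]), (5, [0, 2, 0, 33, 0, 0, 0, 0, 256]),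
    (5, [32, 2, 0, 32, 0, 0, 0, 0, 256]), (5, [0, 6, 0, 0, 0, 0, 0, 0, 260]),
    (5, [40, 130, 0, 0, 0, 0, 0, 0, 384]), (5, [0, 2, 2, 0, 0, 0, 0, 2, 256]),
    (5, [0, 146, 0, 0, 0, 0, 0, 0, 400]), (6, [0, 2, 0, 0, 0, 0, 0, 0, 256]),
    (7, [0, 2, 0, 0, 0, 0, 0, 0, 256])]

theorem choicesC_mats : choicesC.map (fun B => (wordMat B, wordCost B)) = matsC := by
  decide +kernel

theorem choicesD_mats : choicesD.map (fun B => (wordMat B, wordCost B)) = matsD := by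
  decide +kernel

/-- Closedness of a table under right multiplication by blocks, up to matrices with the
entry `(8, 1)`. A block of cost `k` raises the rank by `w * k - 1`, and ranks are only compared
modulo `m`. -/
def tableClosed (T : List (ℕ × List ℕ)) (ch : List (List ℕ × ℕ)) (w m : ℕ) : Bool :=
  T.all fun R => ch.all fun B =>
    ent (matMul R.2 B.1) 8 1 ||
      T.any fun R' => decide (R'.1 + 1 ≤ R.1 + w * B.2) &&
        ((R.1 + w * B.2 - (R'.1 + 1)) % m == 0) && matLe R'.2 (matMul R.2 B.1)

theorem tableC_closed : tableClosed tableC matsC 4 1 = true := by decide +kernel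

theorem tableD_closed : tableClosed tableD matsD 2 2 = true := by decide +kernel

/-- No closed walk leaves the given matching. -/
def noLoop (A : List ℕ) : Bool :=
  !ent A 8 1 && [0, 2, 3, 4, 5, 6, 7].all fun x => !ent A x x

theorem tables_even : (tableD.all fun R => tableC.all fun R' =>
    decide (10 ≤ 2 * R.1 + R'.1) || !noLoop (matMul R.2 R'.2)) = true := by decide +kernel

theorem tables_odd : (tableD.all fun R => tableC.all fun R' =>
    decide (R.1 % 2 = 0) || decide (11 ≤ 2 * R.1 + R'.1) ||
      !noLoop (matMul R.2 R'.2)) = true := by decide +kernel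

theorem tables_one : (matsD.all fun B => tableC.all fun R' =>
    decide (10 ≤ 4 * B.2 + R'.1) || !noLoop (matMul B.1 R'.2)) = true := by decide +kernel

theorem tables_zero : (matsC.all fun B => matsC.all fun B' => tableC.all fun R' =>
    decide (9 ≤ 4 * B.2 + 4 * B'.2 + R'.1) ||
      !noLoop (matMul B.1 (matMul B'.1 R'.2))) = true := by decide +kernel

/-! ### Periodic words -/

/-- The blocks `D` whose prescribed edges are given by the bits of `m`. -/
def maskD (m : ℕ) : List Letter :=
  lettersD (m.testBit 0) (m.testBit 1) (m.testBit 2) (m.testBit 3)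

/-- The blocks `C` whose prescribed edges are given by the bits of `m`. -/
def maskC (m : ℕ) : List Letter := lettersC (m.testBit 0) (m.testBit 1) (m.testBit 2)

theorem lettersC_mem (p q r : Bool) : lettersC p q r ∈ choicesC := by
  revert p q r; decide

theorem lettersD_mem (p q r s : Bool) : lettersD p q r s ∈ choicesD := by
  revert p q r s; decide

/-- Entrywise disjunction of matrices. -/
def matOr (A B : List ℕ) : List ℕ := List.zipWith (· ||| ·) A B

/-- Sixteenth power of `1 ∨ A`. -/
def matStar (A : List ℕ) : List ℕ :=
  let sq (B : List ℕ) := matMul B B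
  sq (sq (sq (sq (matOr matOne A))))

/-- `X` is reflexive and closed under right multiplication by `A`. -/
def isStarOf (X A : List ℕ) : Bool := matLe matOne X && matLe (matMul X A) X

theorem wordCost_append (L L' : List Letter) : wordCost (L ++ L') = wordCost L + wordCost L' := by
  simp [wordCost]

theorem wordCost_replicate (Q : List Letter) (e : ℕ) :
    wordCost (List.replicate e Q).flatten = e * wordCost Q := by
  induction e with
  | zero => simp [wordCost]
  | succ e ih => rw [List.replicate_succ, List.flatten_cons, wordCost_append, ih]; ring

theorem wordMat_replicate_sub {X : List ℕ} {Q : List Letter} (h : isStarOf X (wordMat Q) = true)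
    (e : ℕ) : MatSub (wordMat (List.replicate e Q).flatten) X := by
  simp only [isStarOf, Bool.and_eq_true] at h
  induction e with
  | zero => exact fun x y hxy => matLe_spec h.1 x y hxy
  | succ e ih =>
    rw [List.replicate_succ', List.flatten_append, List.flatten_singleton]
    intro x y hxy
    exact matLe_spec h.2 x y (ih.matMul (fun _ _ => id) x y (append_matSub _ _ x y hxy))

theorem noLoop_anti {A B : List ℕ} (h : MatSub A B) (hB : noLoop B = true) :
    noLoop A = true := by
  have key : ∀ x y, ent B x y = false → ent A x y = false := fun x y hb => by
    by_contra ha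
    rw [h x y (by simpa using ha)] at hb
    exact absurd hb (by decide)
  simp only [noLoop, Bool.and_eq_true, Bool.not_eq_true', List.all_eq_true] at hB ⊢
  exact ⟨key _ _ hB.1, fun x hx => key _ _ (hB.2 x hx)⟩

/-- A choice of prescribed edges of total number `k` in `d` blocks `D` followed by `c` blocks `C`
that leaves no other perfect matching. -/
def HasWord (d c k : ℕ) : Prop :=
  ∃ bd bc : List (List Letter), (∀ b ∈ bd, b ∈ choicesD) ∧ (∀ b ∈ bc, b ∈ choicesC) ∧
    bd.length = d ∧ bc.length = c ∧ wordCost (bd.flatten ++ bc.flatten) = k ∧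
    noLoop (wordMat (bd.flatten ++ bc.flatten)) = true

/-- The words `Q`, `A`, `P`, `B` yield words `Q^e A P^k B` that leave no other perfect matching. -/
def pumpOk (Q A P B : List Letter) : Bool :=
  let X := matStar (wordMat Q)
  let Y := matStar (wordMat P)
  isStarOf X (wordMat Q) && isStarOf Y (wordMat P) &&
    noLoop (matMul (matMul X (wordMat A)) (matMul Y (wordMat B)))

theorem noLoop_of_pumpOk {Q A P B : List Letter} (h : pumpOk Q A P B = true) (e k : ℕ) :
    noLoop (wordMat (((List.replicate e Q).flatten ++ A) ++
      ((List.replicate k P).flatten ++ B))) = true := by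
  simp only [pumpOk, Bool.and_eq_true] at h
  refine noLoop_anti ?_ h.2
  intro x y hxy
  refine MatSub.matMul ?_ ?_ x y (append_matSub _ _ x y hxy)
  · intro x y hxy
    exact (wordMat_replicate_sub h.1.1 e).matMul (fun _ _ => id) x y (append_matSub _ _ x y hxy)
  · intro x y hxy
    exact (wordMat_replicate_sub h.1.2 k).matMul (fun _ _ => id) x y (append_matSub _ _ x y hxy)

theorem flatten_replicate_flatten (e : ℕ) (Q : List (List Letter)) :
    (List.replicate e Q).flatten.flatten = (List.replicate e Q.flatten).flatten := by
  induction e with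
  | zero => rfl
  | succ e ih => simp [List.replicate_succ, ih]

theorem hasWord_pump (Q A P B : List ℕ) {a b w : ℕ}
    (h : pumpOk (Q.map maskD).flatten (A.map maskD).flatten (P.map maskC).flatten
      (B.map maskC).flatten = true)
    (hQ : Q.length = 2 ∧ wordCost (Q.map maskD).flatten = 1)
    (hP : P.length = 4 ∧ wordCost (P.map maskC).flatten = 1)
    (hAB : A.length = a ∧ B.length = b ∧
      wordCost (A.map maskD).flatten + wordCost (B.map maskC).flatten = w) (e k : ℕ) :
    HasWord (e * 2 + a) (k * 4 + b) (e + k + w) := by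
  obtain ⟨rfl, rfl, rfl⟩ := hAB
  refine ⟨(List.replicate e (Q.map maskD)).flatten ++ A.map maskD,
    (List.replicate k (P.map maskC)).flatten ++ B.map maskC, ?_, ?_, ?_, ?_, ?_, ?_⟩
  · intro b hb
    simp only [List.mem_append, List.mem_flatten, List.mem_replicate, List.mem_map] at hb
    rcases hb with ⟨l, ⟨-, rfl⟩, hb⟩ | ⟨m, -, rfl⟩
    · obtain ⟨m, -, rfl⟩ := List.mem_map.1 hb
      exact lettersD_mem _ _ _ _
    · exact lettersD_mem _ _ _ _
  · intro b hb
    simp only [List.mem_append, List.mem_flatten, List.mem_replicate, List.mem_map] at hb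
    rcases hb with ⟨l, ⟨-, rfl⟩, hb⟩ | ⟨m, -, rfl⟩
    · obtain ⟨m, -, rfl⟩ := List.mem_map.1 hb
      exact lettersC_mem _ _ _
    · exact lettersC_mem _ _ _
  · simp [hQ.1]
  · simp [hP.1]
  · rw [List.flatten_append, List.flatten_append, wordCost_append, wordCost_append,
      wordCost_append, flatten_replicate_flatten, flatten_replicate_flatten, wordCost_replicate,
      wordCost_replicate, hQ.2, hP.2]
    ring
  · rw [List.flatten_append, List.flatten_append, flatten_replicate_flatten,
      flatten_replicate_flatten]
    exact noLoop_of_pumpOk h e k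

/-- The claimed forcing number. -/
def forcingValue (d c : ℕ) : ℕ :=
  (6 * d + 3 * c + (if Even d then 9 else 12) + 11) / 12 +
    (if (d = 0 ∧ c % 4 = 1) ∨ (d = 1 ∧ c % 4 = 2) then 1 else 0)

theorem forcingValue_spec (d c : ℕ) : ∃ e x, forcingValue d c = (6 * d + 3 * c + e + 11) / 12 + x ∧
    ((d % 2 = 0 ∧ e = 9) ∨ (d % 2 = 1 ∧ e = 12)) ∧
    ((((d = 0 ∧ c % 4 = 1) ∨ (d = 1 ∧ c % 4 = 2)) ∧ x = 1) ∨
      (¬((d = 0 ∧ c % 4 = 1) ∨ (d = 1 ∧ c % 4 = 2)) ∧ x = 0)) := by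
  refine ⟨_, _, rfl, ?_, ?_⟩
  · by_cases h : Even d
    · exact Or.inl ⟨Nat.even_iff.1 h, if_pos h⟩
    · exact Or.inr ⟨Nat.not_even_iff.1 h, if_neg h⟩
  · by_cases h : (d = 0 ∧ c % 4 = 1) ∨ (d = 1 ∧ c % 4 = 2)
    · exact Or.inl ⟨h, if_pos h⟩
    · exact Or.inr ⟨h, if_neg h⟩

/-- Words with the claimed number of prescribed edges exist. -/
theorem hasWord_forcingValue {d c : ℕ} (hn : 37 ≤ 4 * d + 3 * c) :
    HasWord d c (forcingValue d c) := by
  have conv : ∀ {d' c' k'}, HasWord d' c' k' → d' = d → c' = c → k' = forcingValue d c →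
      HasWord d c (forcingValue d c) := by
    rintro d' c' k' h rfl rfl rfl
    exact h
  obtain ⟨e, x, hv, he, hx⟩ := forcingValue_spec d c
  have hr : c % 4 = 0 ∨ c % 4 = 1 ∨ c % 4 = 2 ∨ c % 4 = 3 := by omega
  have hp : d = 0 ∨ d = 1 ∨ (2 ≤ d ∧ d % 2 = 0) ∨ (2 ≤ d ∧ d % 2 = 1) := by omega
  rcases hp with hp | hp | hp | hp
  · rcases hr with hr | hr | hr | hr
    · exact conv (hasWord_pump [0, 2] [] [0, 0, 0, 2] [0, 0, 0, 3]
        (a := 0) (b := 4) (w := 2) (by decide +kernel) (by decide) (by decide) (by decide)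
        0 (c / 4 - 1))
        (by omega) (by omega) (by omega)
    · exact conv (hasWord_pump [1, 0] [] [2, 0, 0, 0] [3]
        (a := 0) (b := 1) (w := 2) (by decide +kernel) (by decide) (by decide) (by decide)
        0 (c / 4))
        (by omega) (by omega) (by omega)
    · exact conv (hasWord_pump [1, 0] [] [2, 0, 0, 0] [3, 0]
        (a := 0) (b := 2) (w := 2) (by decide +kernel) (by decide) (by decide) (by decide)
        0 (c / 4))
        (by omega) (by omega) (by omega)
    · exact conv (hasWord_pump [0, 2] [] [0, 0, 0, 2] [0, 0, 3]
        (a := 0) (b := 3) (w := 2) (by decide +kernel) (by decide) (by decide) (by decide)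
        0 (c / 4))
        (by omega) (by omega) (by omega)
  · rcases hr with hr | hr | hr | hr
    · exact conv (hasWord_pump [2, 0] [2] [0, 0, 0, 2] [0, 0, 0, 3]
        (a := 1) (b := 4) (w := 3) (by decide +kernel) (by decide) (by decide) (by decide)
        0 (c / 4 - 1))
        (by omega) (by omega) (by omega)
    · exact conv (hasWord_pump [2, 0] [0] [2, 0, 0, 0] [3]
        (a := 1) (b := 1) (w := 2) (by decide +kernel) (by decide) (by decide) (by decide)
        0 (c / 4))
        (by omega) (by omega) (by omega)
    · exact conv (hasWord_pump [1, 0] [4] [0, 2, 0, 0] [0, 3]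
        (a := 1) (b := 2) (w := 3) (by decide +kernel) (by decide) (by decide) (by decide)
        0 (c / 4))
        (by omega) (by omega) (by omega)
    · exact conv (hasWord_pump [2, 0] [2] [0, 0, 0, 2] [0, 0, 3]
        (a := 1) (b := 3) (w := 3) (by decide +kernel) (by decide) (by decide) (by decide)
        0 (c / 4))
        (by omega) (by omega) (by omega)
  · rcases hr with hr | hr | hr | hr
    · by_cases h0 : c = 0
      · exact conv (hasWord_pump [0, 2] [0, 0, 9, 2] [0, 0, 0, 2] []
          (a := 4) (b := 0) (w := 3) (by decide +kernel) (by decide) (by decide) (by decide)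
          (d / 2 - 2) 0)
          (by omega) (by omega) (by omega)
      · exact conv (hasWord_pump [0, 2] [0, 0] [2, 0, 0, 0] [2, 0, 0, 3]
          (a := 2) (b := 4) (w := 3) (by decide +kernel) (by decide) (by decide) (by decide)
          (d / 2 - 1) (c / 4 - 1))
          (by omega) (by omega) (by omega)
    · exact conv (hasWord_pump [0, 2] [0, 0] [2, 0, 0, 0] [3]
        (a := 2) (b := 1) (w := 2) (by decide +kernel) (by decide) (by decide) (by decide)
        (d / 2 - 1) (c / 4))
        (by omega) (by omega) (by omega)
    · exact conv (hasWord_pump [2, 0] [0, 4] [0, 2, 0, 0] [0, 3]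
        (a := 2) (b := 2) (w := 3) (by decide +kernel) (by decide) (by decide) (by decide)
        (d / 2 - 1) (c / 4))
        (by omega) (by omega) (by omega)
    · exact conv (hasWord_pump [0, 2] [0, 0] [2, 0, 0, 0] [2, 0, 3]
        (a := 2) (b := 3) (w := 3) (by decide +kernel) (by decide) (by decide) (by decide)
        (d / 2 - 1) (c / 4))
        (by omega) (by omega) (by omega)
  · rcases hr with hr | hr | hr | hr
    · exact conv (hasWord_pump [2, 0] [0, 9, 2] [0, 0, 0, 2] []
        (a := 3) (b := 0) (w := 3) (by decide +kernel) (by decide) (by decide) (by decide)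
        (d / 2 - 1) (c / 4))
        (by omega) (by omega) (by omega)
    · exact conv (hasWord_pump [2, 0] [0] [2, 0, 0, 0] [3]
        (a := 1) (b := 1) (w := 2) (by decide +kernel) (by decide) (by decide) (by decide)
        (d / 2) (c / 4))
        (by omega) (by omega) (by omega)
    · exact conv (hasWord_pump [0, 2] [0, 0, 4] [0, 2, 0, 0] [0, 3]
        (a := 3) (b := 2) (w := 3) (by decide +kernel) (by decide) (by decide) (by decide)
        (d / 2 - 1) (c / 4))
        (by omega) (by omega) (by omega)
    · exact conv (hasWord_pump [2, 0] [2] [0, 0, 0, 2] [0, 0, 3]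
        (a := 1) (b := 3) (w := 3) (by decide +kernel) (by decide) (by decide) (by decide)
        (d / 2) (c / 4))
        (by omega) (by omega) (by omega)

/-! ### Lower bound for words -/

theorem diag_matsC : (matsC.all fun B => ent B.1 1 1 && ent B.1 8 8) = true := by decide +kernel

theorem diag_matsD : (matsD.all fun B => ent B.1 1 1 && ent B.1 8 8) = true := by decide +kernel

theorem matOne_mem_tableC : (3, matOne) ∈ tableC := by decide +kernel

theorem matOne_mem_tableD : (2, matOne) ∈ tableD := by decide +kernel

section

variable {ch : List (List Letter)} {mats : List (List ℕ × ℕ)}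

theorem mem_mats (hm : ch.map (fun B => (wordMat B, wordCost B)) = mats) {b : List Letter}
    (hb : b ∈ ch) : (wordMat b, wordCost b) ∈ mats :=
  hm ▸ List.mem_map.2 ⟨b, hb, rfl⟩

/-- The given matching itself is a closed walk along every word. -/
theorem ent_diag (hm : ch.map (fun B => (wordMat B, wordCost B)) = mats)
    (hd : (mats.all fun B => ent B.1 1 1 && ent B.1 8 8) = true)
    {bs : List (List Letter)} (hbs : ∀ b ∈ bs, b ∈ ch) :
    ent (wordMat bs.flatten) 1 1 = true ∧ ent (wordMat bs.flatten) 8 8 = true := by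
  induction bs with
  | nil => exact ⟨(ent_matOne _ _).2 (by simp), (ent_matOne _ _).2 (by simp)⟩
  | cons b bs ih =>
    have h := List.all_eq_true.1 hd _ (mem_mats hm (hbs b (by simp)))
    rw [Bool.and_eq_true] at h
    obtain ⟨h1, h8⟩ := ih fun b' hb' => hbs b' (by simp [hb'])
    exact ⟨matSub_append _ _ _ _ ((ent_matMul _ _ _ _).2 ⟨1, h.1, h1⟩),
      matSub_append _ _ _ _ ((ent_matMul _ _ _ _).2 ⟨8, h.2, h8⟩)⟩

/-- Ranks in a closed table bound the cost of words from below. -/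
theorem exists_rank {T : List (ℕ × List ℕ)} {w m r : ℕ}
    (hm : ch.map (fun B => (wordMat B, wordCost B)) = mats)
    (hd : (mats.all fun B => ent B.1 1 1 && ent B.1 8 8) = true)
    (hT : tableClosed T mats w m = true) (hr : (r, matOne) ∈ T)
    {bs : List (List Letter)} (hbs : ∀ b ∈ bs, b ∈ ch) :
    ent (wordMat bs.flatten) 8 1 = true ∨ ∃ R ∈ T, MatSub R.2 (wordMat bs.flatten) ∧
      ∃ t, R.1 + bs.length + m * t = r + w * wordCost bs.flatten := by
  induction bs using List.reverseRecOn with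
  | nil => exact Or.inr ⟨_, hr, fun _ _ => id, 0, by simp [wordCost]⟩
  | append_singleton bs b ih =>
    have hb := mem_mats hm (hbs b (by simp))
    have hflat : (bs ++ [b]).flatten = bs.flatten ++ b := by simp
    rw [hflat, wordCost_append, List.length_append, List.length_singleton]
    rcases ih fun b' hb' => hbs b' (by simp [hb']) with h | ⟨R, hR, hsub, t, ht⟩
    · have h1 := List.all_eq_true.1 hd _ hb
      rw [Bool.and_eq_true] at h1
      exact Or.inl (matSub_append _ _ _ _ ((ent_matMul _ _ _ _).2 ⟨1, h, h1.1⟩))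
    · have h2 : MatSub (matMul R.2 (wordMat b)) (wordMat (bs.flatten ++ b)) := fun x y h =>
        matSub_append _ _ x y (hsub.matMul (fun _ _ => id) x y h)
      have h1 := List.all_eq_true.1 (List.all_eq_true.1 hT _ hR) _ hb
      rw [Bool.or_eq_true, List.any_eq_true] at h1
      rcases h1 with h1 | ⟨R', hR', h1⟩
      · exact Or.inl (h2 _ _ h1)
      · simp only [Bool.and_eq_true, decide_eq_true_eq, beq_iff_eq] at h1
        obtain ⟨⟨h3, h4⟩, h5⟩ := h1
        obtain ⟨s, hs⟩ := Nat.dvd_of_mod_eq_zero h4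
        refine Or.inr ⟨R', hR', fun x y h => h2 x y (matLe_spec h5 x y h), t + s, ?_⟩
        rw [mul_add, mul_add]
        omega

end

theorem not_ent_of_noLoop {A : List ℕ} (h : noLoop A = true) : ¬ ent A 8 1 = true := by
  intro h8
  simp [noLoop, h8] at h

theorem exists_rankC {bc : List (List Letter)} (hbc : ∀ b ∈ bc, b ∈ choicesC)
    (h : ¬ ent (wordMat bc.flatten) 8 1 = true) :
    ∃ R ∈ tableC, MatSub R.2 (wordMat bc.flatten) ∧
      R.1 + bc.length ≤ 3 + 4 * wordCost bc.flatten := by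
  obtain ⟨R, hR, hs, t, ht⟩ := (exists_rank choicesC_mats diag_matsC tableC_closed
    matOne_mem_tableC hbc).resolve_left h
  exact ⟨R, hR, hs, by omega⟩

/-- Every choice of prescribed edges that leaves no other perfect matching is large enough. -/
theorem forcingValue_le {bd bc : List (List Letter)} (hbd : ∀ b ∈ bd, b ∈ choicesD)
    (hbc : ∀ b ∈ bc, b ∈ choicesC) (hn : 37 ≤ 4 * bd.length + 3 * bc.length)
    (h : noLoop (wordMat (bd.flatten ++ bc.flatten)) = true) :
    forcingValue bd.length bc.length ≤ wordCost (bd.flatten ++ bc.flatten) := by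
  have hno := not_ent_of_noLoop h
  obtain ⟨hD1, hD8⟩ := ent_diag choicesD_mats diag_matsD hbd
  obtain ⟨hC1, hC8⟩ := ent_diag choicesC_mats diag_matsC hbc
  obtain ⟨R, hR, hRs, t, ht⟩ := (exists_rank choicesD_mats diag_matsD tableD_closed
    matOne_mem_tableD hbd).resolve_left fun h' =>
      hno (matSub_append _ _ _ _ ((ent_matMul _ _ _ _).2 ⟨1, h', hC1⟩))
  have hC : ¬ ent (wordMat bc.flatten) 8 1 = true := fun h' =>
      hno (matSub_append _ _ _ _ ((ent_matMul _ _ _ _).2 ⟨8, hD8, h'⟩))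
  obtain ⟨R', hR', hRs', ht'⟩ := exists_rankC hbc hC
  have hloop : noLoop (matMul R.2 R'.2) = true :=
    noLoop_anti (fun x y hxy => matSub_append _ _ x y (hRs.matMul hRs' x y hxy)) h
  obtain ⟨e, x, hv, he, hx⟩ := forcingValue_spec bd.length bc.length
  rw [hv, wordCost_append]
  have h_even := List.all_eq_true.1 (List.all_eq_true.1 tables_even _ hR) _ hR'
  have h_odd := List.all_eq_true.1 (List.all_eq_true.1 tables_odd _ hR) _ hR'
  simp only [hloop, Bool.not_true, Bool.or_false, Bool.or_eq_true, decide_eq_true_eq]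
    at h_even h_odd
  match bd, hbd with
  | [], _ =>
    match bc, hbc with
    | [], _ => simp at hn
    | [_], _ => simp at hn
    | b :: b' :: bs, hb =>
      have hb1 := mem_mats choicesC_mats (hb b (by simp))
      have hb2 := mem_mats choicesC_mats (hb b' (by simp))
      have h1 := List.all_eq_true.1 diag_matsC _ hb1
      have h2 := List.all_eq_true.1 diag_matsC _ hb2
      rw [Bool.and_eq_true] at h1 h2
      obtain ⟨Q, hQ, hQs, hQt⟩ := exists_rankC (bc := bs) (fun b hb' => hb b (by simp [hb']))
        fun h' => hC (matSub_append _ _ _ _ ((ent_matMul _ _ _ _).2 ⟨8, h1.2,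
          matSub_append _ _ _ _ ((ent_matMul _ _ _ _).2 ⟨8, h2.2, h'⟩)⟩))
      have hl : noLoop (matMul (wordMat b) (matMul (wordMat b') Q.2)) = true := by
        refine noLoop_anti (fun x y hxy => ?_) h
        refine matSub_append b (b' ++ bs.flatten) x y ?_
        refine MatSub.matMul (fun _ _ => id) ?_ x y hxy
        intro x y hxy
        refine matSub_append b' bs.flatten x y ?_
        exact MatSub.matMul (fun _ _ => id) hQs x y hxy
      have h3 := List.all_eq_true.1 (List.all_eq_true.1 (List.all_eq_true.1 tables_zero _ hb1)
        _ hb2) _ hQ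
      simp only [hl, Bool.not_true, Bool.or_false, decide_eq_true_eq] at h3
      simp only [List.flatten_cons, wordCost_append, List.flatten_nil, List.length_cons,
        List.length_nil] at *
      omega
  | [b], hb =>
    have hb1 := mem_mats choicesD_mats (hb b (by simp))
    have hl : noLoop (matMul (wordMat b) R'.2) = true := by
      refine noLoop_anti (fun x y hxy => ?_) h
      rw [List.flatten_singleton]
      exact matSub_append _ _ x y (MatSub.matMul (fun _ _ => id) hRs' x y hxy)
    have h3 := List.all_eq_true.1 (List.all_eq_true.1 tables_one _ hb1) _ hR'
    simp only [hl, Bool.not_true, Bool.or_false, decide_eq_true_eq] at h3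
    simp only [List.flatten_singleton, List.length_cons, List.length_nil] at *
    omega
  | b :: b' :: bs, _ =>
    simp only [List.length_cons] at *
    omega

/-! ### Edges of `P(n,2)` -/

/-- The spoke (`t = 0`), the outer edge (`t = 1`) and the inner edge (`t = 2`) at position `i`. -/
def edg {n : ℕ} (t : Fin 3) (i : ZMod n) : Sym2 (PV n) :=
  match t with
  | 0 => s(pu i, pv i)
  | 1 => s(pu i, pu (i + 2))
  | 2 => s(pv i, pv (i + 1))

theorem zmod_ne_zero {n k : ℕ} (h0 : k ≠ 0) (hk : k < n) : (k : ZMod n) ≠ 0 := by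
  rw [Ne, ZMod.natCast_eq_zero_iff]
  exact fun h => absurd (Nat.le_of_dvd (by omega) h) (by omega)

theorem zmod_small {n : ℕ} (hn : 5 ≤ n) :
    (1 : ZMod n) ≠ 0 ∧ (2 : ZMod n) ≠ 0 ∧ (4 : ZMod n) ≠ 0 := by
  have h1 := zmod_ne_zero (n := n) one_ne_zero (by omega)
  have h2 := zmod_ne_zero (n := n) two_ne_zero (by omega)
  have h4 := zmod_ne_zero (n := n) four_ne_zero (by omega)
  exact ⟨by exact_mod_cast h1, by exact_mod_cast h2, by exact_mod_cast h4⟩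

theorem edg_inj {n : ℕ} (hn : 5 ≤ n) {t t' : Fin 3} {i i' : ZMod n} :
    edg t i = edg t' i' ↔ t = t' ∧ i = i' := by
  obtain ⟨h1, h2, h4⟩ := zmod_small hn
  refine ⟨fun h => ?_, by rintro ⟨rfl, rfl⟩; rfl⟩
  fin_cases t <;> fin_cases t' <;> simp [edg, pu, pv] at h ⊢
  · exact h
  · rcases h with h | ⟨h, h'⟩
    · exact h
    · exact absurd (by linear_combination h' - h) h4
  · rcases h with h | ⟨h, h'⟩
    · exact h
    · exact absurd (by linear_combination h' - h) h2

theorem petersen_adj_iff {n : ℕ} (hn : 5 ≤ n) {a b : PV n} :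
    (petersen n).Adj a b ↔ ∃ t i, edg t i = s(a, b) := by
  obtain ⟨h1, h2, h4⟩ := zmod_small hn
  rw [petersen, SimpleGraph.fromRel_adj]
  constructor
  · rintro ⟨-, (⟨i, rfl, rfl⟩ | ⟨i, rfl, rfl⟩ | ⟨i, rfl, rfl⟩) |
      (⟨i, rfl, rfl⟩ | ⟨i, rfl, rfl⟩ | ⟨i, rfl, rfl⟩)⟩
    · exact ⟨1, i, rfl⟩
    · exact ⟨0, i, rfl⟩
    · exact ⟨2, i, rfl⟩
    · exact ⟨1, i, Sym2.eq_swap⟩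
    · exact ⟨0, i, Sym2.eq_swap⟩
    · exact ⟨2, i, Sym2.eq_swap⟩
  · rintro ⟨t, i, h⟩
    fin_cases t
    · rcases Sym2.eq_iff.1 h with ⟨rfl, rfl⟩ | ⟨rfl, rfl⟩
      · exact ⟨by simp [pu, pv], Or.inl (Or.inr (Or.inl ⟨i, rfl, rfl⟩))⟩
      · exact ⟨by simp [pu, pv], Or.inr (Or.inr (Or.inl ⟨i, rfl, rfl⟩))⟩
    · rcases Sym2.eq_iff.1 h with ⟨rfl, rfl⟩ | ⟨rfl, rfl⟩
      · exact ⟨by simpa [pu] using h2, Or.inl (Or.inl ⟨i, rfl, rfl⟩)⟩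
      · exact ⟨by simpa [pu] using h2, Or.inr (Or.inl ⟨i, rfl, rfl⟩)⟩
    · rcases Sym2.eq_iff.1 h with ⟨rfl, rfl⟩ | ⟨rfl, rfl⟩
      · exact ⟨by simpa [pv] using h1, Or.inl (Or.inr (Or.inr ⟨i, rfl, rfl⟩))⟩
      · exact ⟨by simpa [pv] using h1, Or.inr (Or.inr (Or.inr ⟨i, rfl, rfl⟩))⟩

theorem exists_edg {n : ℕ} (hn : 5 ≤ n) {M : (petersen n).Subgraph} {e : Sym2 (PV n)}
    (he : e ∈ M.edgeSet) : ∃ t i, edg t i = e := by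
  induction e with
  | h a b => exact (petersen_adj_iff hn).1 (M.adj_sub he)

/-! ### Perfect matchings as Boolean configurations -/

/-- Exactly one of three truth values is true. -/
def one3 (a b c : Bool) : Bool := (a && !b && !c) || (!a && b && !c) || (!a && !b && c)

open Classical in
theorem existsUnique_iff_one3 {α : Type*} {P : α → Prop} {a b c : α} (hab : a ≠ b) (hac : a ≠ c)
    (hbc : b ≠ c) (h : ∀ w, P w → w = a ∨ w = b ∨ w = c) :
    (∃! w, P w) ↔ one3 (decide (P a)) (decide (P b)) (decide (P c)) = true := by
  constructor
  · rintro ⟨w, hw, huniq⟩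
    rcases h w hw with rfl | rfl | rfl
    · have hb : ¬ P b := fun hb => hab (huniq b hb).symm
      have hc : ¬ P c := fun hc => hac (huniq c hc).symm
      simp [one3, hw, hb, hc]
    · have ha : ¬ P a := fun ha => hab (huniq a ha)
      have hc : ¬ P c := fun hc => hbc (huniq c hc).symm
      simp [one3, hw, ha, hc]
    · have ha : ¬ P a := fun ha => hac (huniq a ha)
      have hb : ¬ P b := fun hb => hbc (huniq b hb)
      simp [one3, hw, ha, hb]
  · intro h1
    by_cases ha : P a <;> by_cases hb : P b <;> by_cases hc : P c <;>
      simp [one3, ha, hb, hc] at h1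
    · refine ⟨a, ha, fun w hw => ?_⟩
      rcases h w hw with rfl | rfl | rfl
      · rfl
      · exact absurd hw hb
      · exact absurd hw hc
    · refine ⟨b, hb, fun w hw => ?_⟩
      rcases h w hw with rfl | rfl | rfl
      · exact absurd hw ha
      · rfl
      · exact absurd hw hc
    · refine ⟨c, hc, fun w hw => ?_⟩
      rcases h w hw with rfl | rfl | rfl
      · exact absurd hw ha
      · exact absurd hw hb
      · rfl

open Classical in
/-- Whether `M` uses a given edge. -/
noncomputable def uses {n : ℕ} (M : (petersen n).Subgraph) (t : Fin 3) (i : ZMod n) : Bool :=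
  decide (edg t i ∈ M.edgeSet)

theorem uses_iff {n : ℕ} {M : (petersen n).Subgraph} {t : Fin 3} {i : ZMod n} :
    uses M t i = true ↔ edg t i ∈ M.edgeSet := by
  simp [uses]

open Classical in
theorem uses_eq_decide {n : ℕ} {M : (petersen n).Subgraph} {t : Fin 3} {i : ZMod n} {a b : PV n}
    (h : edg t i = s(a, b)) : uses M t i = decide (M.Adj a b) := by
  rw [Bool.eq_iff_iff, uses_iff, h, Subgraph.mem_edgeSet, decide_eq_true_eq]

/-- Every vertex is covered exactly once. -/
def Valid {n : ℕ} (x : Fin 3 → ZMod n → Bool) : Prop :=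
  ∀ i, one3 (x 0 i) (x 1 i) (x 1 (i - 2)) = true ∧ one3 (x 0 i) (x 2 i) (x 2 (i - 1)) = true

theorem petersen_adj_pu {n : ℕ} (hn : 5 ≤ n) {i : ZMod n} {w : PV n}
    (h : (petersen n).Adj (pu i) w) : w = pv i ∨ w = pu (i + 2) ∨ w = pu (i - 2) := by
  obtain ⟨t, j, h⟩ := (petersen_adj_iff hn).1 h
  fin_cases t
  · rcases Sym2.eq_iff.1 h with ⟨h1, rfl⟩ | ⟨rfl, h1⟩
    · exact Or.inl (congrArg pv (Sum.inl.inj h1))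
    · exact absurd h1 Sum.inr_ne_inl
  · rcases Sym2.eq_iff.1 h with ⟨h1, rfl⟩ | ⟨rfl, h1⟩
    · exact Or.inr (Or.inl (congrArg (fun k => pu (k + 2)) (Sum.inl.inj h1)))
    · refine Or.inr (Or.inr ?_)
      rw [← Sum.inl.inj h1, add_sub_cancel_right]
  · rcases Sym2.eq_iff.1 h with ⟨h1, rfl⟩ | ⟨rfl, h1⟩ <;> exact absurd h1 Sum.inr_ne_inl

theorem petersen_adj_pv {n : ℕ} (hn : 5 ≤ n) {i : ZMod n} {w : PV n}
    (h : (petersen n).Adj (pv i) w) : w = pu i ∨ w = pv (i + 1) ∨ w = pv (i - 1) := by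
  obtain ⟨t, j, h⟩ := (petersen_adj_iff hn).1 h
  fin_cases t
  · rcases Sym2.eq_iff.1 h with ⟨h1, rfl⟩ | ⟨rfl, h1⟩
    · exact absurd h1 Sum.inl_ne_inr
    · exact Or.inl (congrArg pu (Sum.inr.inj h1))
  · rcases Sym2.eq_iff.1 h with ⟨h1, rfl⟩ | ⟨rfl, h1⟩ <;> exact absurd h1 Sum.inl_ne_inr
  · rcases Sym2.eq_iff.1 h with ⟨h1, rfl⟩ | ⟨rfl, h1⟩
    · exact Or.inr (Or.inl (congrArg (fun k => pv (k + 1)) (Sum.inr.inj h1)))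
    · refine Or.inr (Or.inr ?_)
      rw [← Sum.inr.inj h1, add_sub_cancel_right]

theorem isPerfectMatching_iff_valid {n : ℕ} (hn : 5 ≤ n) (M : (petersen n).Subgraph) :
    M.IsPerfectMatching ↔ Valid (uses M) := by
  obtain ⟨h1, h2, h4⟩ := zmod_small hn
  have hu : ∀ i, (∃! w, M.Adj (pu i) w) ↔
      one3 (uses M 0 i) (uses M 1 i) (uses M 1 (i - 2)) = true := by
    intro i
    rw [existsUnique_iff_one3 (a := pv i) (b := pu (i + 2)) (c := pu (i - 2)) (by simp [pu, pv])
      (by simp [pu, pv]) (fun h => h4 (by linear_combination Sum.inl.inj h))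
      fun w hw => petersen_adj_pu hn (M.adj_sub hw)]
    have h3 : edg 1 (i - 2) = s(pu i, pu (i - 2)) := by
      rw [edg, sub_add_cancel, Sym2.eq_swap]
    rw [uses_eq_decide h3, uses_eq_decide (t := 0) (i := i) rfl,
      uses_eq_decide (t := 1) (i := i) rfl]
  have hv : ∀ i, (∃! w, M.Adj (pv i) w) ↔
      one3 (uses M 0 i) (uses M 2 i) (uses M 2 (i - 1)) = true := by
    intro i
    rw [existsUnique_iff_one3 (a := pu i) (b := pv (i + 1)) (c := pv (i - 1)) (by simp [pu, pv])
      (by simp [pu, pv]) (fun h => h2 (by linear_combination Sum.inr.inj h))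
      fun w hw => petersen_adj_pv hn (M.adj_sub hw)]
    have h3 : edg 2 (i - 1) = s(pv i, pv (i - 1)) := by
      rw [edg, sub_add_cancel, Sym2.eq_swap]
    have h4 : edg 0 i = s(pv i, pu i) := Sym2.eq_swap
    rw [uses_eq_decide h3, uses_eq_decide h4, uses_eq_decide (t := 2) (i := i) rfl]
  rw [Subgraph.isPerfectMatching_iff]
  constructor
  · exact fun h i => ⟨(hu i).1 (h _), (hv i).1 (h _)⟩
  · rintro h (i | i)
    · exact (hu i).2 (h i).1
    · exact (hv i).2 (h i).2

theorem eq_of_uses_eq {n : ℕ} (hn : 5 ≤ n) {M M' : (petersen n).Subgraph}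
    (hM : M.IsPerfectMatching) (hM' : M'.IsPerfectMatching) (h : uses M = uses M') : M = M' := by
  have key : ∀ {M M' : (petersen n).Subgraph}, uses M = uses M' →
      ∀ a b, M.Adj a b → M'.Adj a b := by
    intro M M' h a b hab
    obtain ⟨t, i, he⟩ := (petersen_adj_iff hn).1 (M.adj_sub hab)
    rw [← Subgraph.mem_edgeSet, ← he, ← uses_iff] at hab ⊢
    rw [← h]
    exact hab
  refine Subgraph.ext ?_ ?_
  · rw [hM.2.verts_eq_univ, hM'.2.verts_eq_univ]
  · ext a b
    exact ⟨key h a b, key h.symm a b⟩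

/-- The subgraph with a prescribed set of edges. -/
def ofConf {n : ℕ} (hn : 5 ≤ n) (x : Fin 3 → ZMod n → Bool) : (petersen n).Subgraph where
  verts := Set.univ
  Adj a b := ∃ t i, x t i = true ∧ edg t i = s(a, b)
  adj_sub := fun ⟨t, i, _, h⟩ => (petersen_adj_iff hn).2 ⟨t, i, h⟩
  edge_vert _ := Set.mem_univ _
  symm := ⟨fun _ _ ⟨t, i, hx, h⟩ => ⟨t, i, hx, h.trans Sym2.eq_swap⟩⟩

theorem uses_ofConf {n : ℕ} (hn : 5 ≤ n) (x : Fin 3 → ZMod n → Bool) : uses (ofConf hn x) = x := by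
  ext t i
  rw [Bool.eq_iff_iff, uses_iff]
  have : ∀ e, e ∈ (ofConf hn x).edgeSet ↔ ∃ t i, x t i = true ∧ edg t i = e := by
    intro e
    induction e with
    | h a b => rfl
  rw [this]
  constructor
  · rintro ⟨t', i', hx, h⟩
    obtain ⟨rfl, rfl⟩ := (edg_inj hn).1 h
    exact hx
  · exact fun h => ⟨t, i, h, rfl⟩

/-! ### Perfect matchings as closed walks -/

/-- The state with given bits. -/
def code (p q r : Bool) : ℕ := 4 * p.toNat + 2 * q.toNat + r.toNat

theorem code_lt (p q r : Bool) : code p q r < 8 := by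
  revert p q r; decide

theorem stepOk_code {p q r a s w : Bool} (h : one3 a s p = true) (h' : one3 a w r = true) :
    stepOk (code p q r) (code q s w) = true ∧ lab 0 (code p q r) (code q s w) = a ∧
      lab 1 (code p q r) (code q s w) = s ∧ lab 2 (code p q r) (code q s w) = w := by
  revert p q r a s w; decide

theorem one3_lab {x y : ℕ} (h : stepOk x y = true) :
    one3 (lab 0 x y) (lab 1 x y) (x.testBit 2) = true ∧
      one3 (lab 0 x y) (lab 2 x y) (x.testBit 0) = true := by
  unfold stepOk at h
  unfold lab one3
  revert h
  generalize x.testBit 2 = a, x.testBit 1 = b, x.testBit 0 = c, y.testBit 2 = d,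
    y.testBit 1 = e, y.testBit 0 = f
  revert a b c d e f
  decide

theorem testBit_two_of_stepOk {x y : ℕ} (h : stepOk x y = true) :
    y.testBit 2 = x.testBit 1 := by
  simp only [stepOk, Bool.and_eq_true, beq_iff_eq] at h
  exact h.1.1.1

theorem state_ext {x y : ℕ} (hx : x < 8) (hy : y < 8) (h0 : x.testBit 0 = y.testBit 0)
    (h1 : x.testBit 1 = y.testBit 1) (h2 : x.testBit 2 = y.testBit 2) : x = y := by
  have : ∀ x < 8, ∀ y < 8, Nat.testBit x 0 = Nat.testBit y 0 → Nat.testBit x 1 = Nat.testBit y 1 →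
      Nat.testBit x 2 = Nat.testBit y 2 → x = y := by decide
  exact this x hx y hy h0 h1 h2

/-- Whether the edge of kind `t` is prescribed. -/
def pres (l : Letter) (t : Fin 3) : Bool :=
  match t with
  | 0 => l.2.2.1
  | 1 => l.2.2.2.1
  | 2 => l.2.2.2.2

theorem letterOk_iff {l : Letter} {x y : ℕ} :
    letterOk l x y = true ↔ stepOk x y = true ∧ ∀ t, pres l t = true → lab t x y = true := by
  simp only [Fin.forall_fin_succ, letterOk, Bool.and_eq_true,
    Bool.or_eq_true, Bool.not_eq_true']
  simp only [pres, Fin.succ_zero_eq_one, Fin.succ_one_eq_two, IsEmpty.forall_iff, and_true]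
  cases l.2.2.1 <;> cases l.2.2.2.1 <;> cases l.2.2.2.2 <;> simp [and_assoc]

/-- A closed walk along the letters `ℓ` that differs from `μ`. -/
def Deviates (n : ℕ) (ℓ : ℕ → Letter) (μ : ℕ → ℕ) : Prop :=
  ∃ τ : ℕ → ℕ, τ n = τ 0 ∧ (∀ i ≤ n, τ i < 8) ∧
    (∀ i < n, letterOk (ℓ i) (τ i) (τ (i + 1)) = true) ∧ ∃ i ≤ n, τ i ≠ μ i

theorem val_add_one_of_closed {n : ℕ} [NeZero n] {τ : ℕ → ℕ} (h : τ n = τ 0) (i : ZMod n) :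
    τ (i + 1).val = τ (i.val + 1) := by
  have hi : i + 1 = ((i.val + 1 : ℕ) : ZMod n) := by simp
  rcases Nat.lt_or_ge (i.val + 1) n with hlt | hge
  · rw [hi, ZMod.val_natCast_of_lt hlt]
  · have he : i.val + 1 = n := le_antisymm (ZMod.val_lt i) hge
    rw [hi, he, ZMod.natCast_self, ZMod.val_zero, h]

theorem walk_ext {n : ℕ} (hn : 0 < n) {τ μ : ℕ → ℕ} (hτn : τ n = τ 0) (hμn : μ n = μ 0)
    (hτ8 : ∀ i ≤ n, τ i < 8) (hμ8 : ∀ i ≤ n, μ i < 8)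
    (hτ : ∀ i < n, stepOk (τ i) (τ (i + 1)) = true)
    (hμ : ∀ i < n, stepOk (μ i) (μ (i + 1)) = true)
    (h : ∀ i < n, ∀ t, lab t (τ i) (τ (i + 1)) = lab t (μ i) (μ (i + 1))) :
    ∀ i ≤ n, τ i = μ i := by
  have hbit : ∀ i ≤ n, (τ i).testBit 0 = (μ i).testBit 0 ∧ (τ i).testBit 1 = (μ i).testBit 1 := by
    have hs : ∀ i < n, (τ (i + 1)).testBit 0 = (μ (i + 1)).testBit 0 ∧
        (τ (i + 1)).testBit 1 = (μ (i + 1)).testBit 1 := fun i hi => ⟨h i hi 2, h i hi 1⟩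
    intro i hi
    cases i with
    | zero =>
      obtain ⟨m, rfl⟩ := Nat.exists_eq_succ_of_ne_zero hn.ne'
      rw [← hτn, ← hμn]
      exact hs m (by omega)
    | succ i => exact hs i (by omega)
  have hs : ∀ i < n, τ (i + 1) = μ (i + 1) := fun i hi =>
    state_ext (hτ8 _ hi) (hμ8 _ hi) (hbit _ hi).1 (hbit _ hi).2 (by
      rw [testBit_two_of_stepOk (hτ i hi), testBit_two_of_stepOk (hμ i hi), (hbit i hi.le).2])
  intro i hi
  cases i with
  | zero =>
    obtain ⟨m, rfl⟩ := Nat.exists_eq_succ_of_ne_zero hn.ne'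
    rw [← hτn, ← hμn]
    exact hs m (by omega)
  | succ i => exact hs i (by omega)

/-- Whether an edge is prescribed. -/
noncomputable def mark {n : ℕ} (S : Set (Sym2 (PV n))) (t : Fin 3) (i : ℕ) : Bool :=
  @decide (edg t (i : ZMod n) ∈ S) (Classical.propDecidable _)

theorem mark_iff {n : ℕ} {S : Set (Sym2 (PV n))} {t : Fin 3} {i : ℕ} :
    mark S t i = true ↔ edg t (i : ZMod n) ∈ S :=
  @decide_eq_true_iff _ (Classical.propDecidable _)

/-- The letters of a set of prescribed edges. -/
noncomputable def letterOf {n : ℕ} (μ : ℕ → ℕ) (S : Set (Sym2 (PV n))) (i : ℕ) : Letter :=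
  (μ i, μ (i + 1), mark S 0 i, mark S 1 i, mark S 2 i)

theorem pres_letterOf {n : ℕ} {μ : ℕ → ℕ} {S : Set (Sym2 (PV n))} {i : ℕ} {t : Fin 3} :
    pres (letterOf μ S i) t = true ↔ edg t (i : ZMod n) ∈ S := by
  fin_cases t <;> exact mark_iff

/-- The closed walk `μ` traces the perfect matching `M`. -/
structure Traces {n : ℕ} (M : (petersen n).Subgraph) (μ : ℕ → ℕ) : Prop where
  closed : μ n = μ 0
  zero : μ 0 = 1
  lt : ∀ i ≤ n, μ i < 8
  step : ∀ i < n, stepOk (μ i) (μ (i + 1)) = true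
  uses_eq : ∀ i < n, ∀ t, uses M t (i : ZMod n) = lab t (μ i) (μ (i + 1))

theorem uses_ext {n : ℕ} [NeZero n] {M M' : (petersen n).Subgraph}
    (h : ∀ i < n, ∀ t, uses M t (i : ZMod n) = uses M' t (i : ZMod n)) : uses M = uses M' := by
  ext t i
  have := h i.val (ZMod.val_lt i) t
  rwa [ZMod.natCast_zmod_val] at this

theorem isForcingSet_iff {n : ℕ} (hn : 5 ≤ n) {M : (petersen n).Subgraph}
    (hM : M.IsPerfectMatching) {μ : ℕ → ℕ} (hμ : Traces M μ) {S : Set (Sym2 (PV n))}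
    (hS : S ⊆ M.edgeSet) :
    IsForcingSet (petersen n) M S ↔ ¬ Deviates n (letterOf μ S) μ := by
  have : NeZero n := ⟨by omega⟩
  constructor
  · rintro ⟨-, hF⟩ ⟨τ, hτn, hτ8, hτ, i, hi, hne⟩
    have hs : ∀ j < n, stepOk (τ j) (τ (j + 1)) = true := fun j hj => (letterOk_iff.1 (hτ j hj)).1
    set x : Fin 3 → ZMod n → Bool := fun t j => lab t (τ j.val) (τ (j.val + 1)) with hx
    have hprev : ∀ j : ZMod n, τ ((j - 1).val + 1) = τ j.val := fun j => by
      rw [← val_add_one_of_closed hτn, sub_add_cancel]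
    have hval : Valid x := by
      intro j
      have hb2 : x 1 (j - 2) = (τ j.val).testBit 2 := by
        have h1 : j - 2 = j - 1 - 1 := by ring
        have h2 := testBit_two_of_stepOk (hs _ (ZMod.val_lt (j - 1)))
        rw [hprev] at h2
        rw [h2, ← hprev (j - 1), ← h1]
        rfl
      have hb0 : x 2 (j - 1) = (τ j.val).testBit 0 := by
        rw [← hprev j]
        rfl
      rw [hb2, hb0]
      exact one3_lab (hs _ (ZMod.val_lt j))
    have huses := uses_ofConf hn x
    have hPM : (ofConf hn x).IsPerfectMatching := by
      rw [isPerfectMatching_iff_valid hn, huses]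
      exact hval
    have heq := hF _ hPM (fun e he => by
      obtain ⟨t, j, rfl⟩ := exists_edg hn (hS he)
      rw [← uses_iff, huses]
      refine (letterOk_iff.1 (hτ _ (ZMod.val_lt j))).2 t (pres_letterOf.2 ?_)
      rwa [ZMod.natCast_zmod_val])
    refine hne (walk_ext (by omega) hτn hμ.closed hτ8 hμ.lt hs hμ.step (fun j hj t => ?_) i hi)
    rw [← hμ.uses_eq j hj, ← heq, huses, hx]
    simp only [ZMod.val_natCast_of_lt hj]
  · intro hdev
    refine ⟨hS, fun M' hM' hS' => ?_⟩
    by_contra hne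
    have hval := (isPerfectMatching_iff_valid hn M').1 hM'
    set x := uses M' with hx
    let τ : ℕ → ℕ := fun i =>
      code (x 1 ((i : ZMod n) - 2)) (x 1 ((i : ZMod n) - 1)) (x 2 ((i : ZMod n) - 1))
    have hsucc : ∀ i : ℕ, τ (i + 1) = code (x 1 ((i : ZMod n) - 1)) (x 1 i) (x 2 i) := by
      intro i
      have h1 : ((i + 1 : ℕ) : ZMod n) - 2 = i - 1 := by push_cast; ring
      have h2 : ((i + 1 : ℕ) : ZMod n) - 1 = i := by push_cast; ring
      simp only [τ, h1, h2]
    have hτ : ∀ i : ℕ, stepOk (τ i) (τ (i + 1)) = true ∧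
        ∀ t, lab t (τ i) (τ (i + 1)) = x t i := by
      intro i
      rw [hsucc]
      obtain ⟨h1, h2, h3, h4⟩ := stepOk_code (q := x 1 ((i : ZMod n) - 1)) (hval i).1 (hval i).2
      refine ⟨h1, fun t => ?_⟩
      fin_cases t
      · exact h2
      · exact h3
      · exact h4
    refine hdev ⟨τ, by simp [τ], fun i _ => code_lt _ _ _, fun i _ => ?_, ?_⟩
    · refine letterOk_iff.2 ⟨(hτ i).1, fun t ht => ?_⟩
      rw [(hτ i).2, hx, uses_iff]
      exact hS' (pres_letterOf.1 ht)
    · by_contra! hall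
      refine hne (eq_of_uses_eq hn hM' hM (uses_ext fun i hi t => ?_))
      rw [hμ.uses_eq i hi, ← hall i hi.le, ← hall (i + 1) hi, (hτ i).2]

/-! ### Closed walks and loops of word matrices -/

theorem transOk_iff {l : Letter} {x y : ℕ} : transOk l x y = true ↔
    (y < 8 ∧ ((x < 8 ∧ letterOk l x y = true) ∨
      (x = 8 ∧ letterOk l l.1 y = true ∧ y ≠ l.2.1))) ∨ (x = 8 ∧ y = 8) := by
  simp [transOk, and_assoc]

theorem noLoop_iff {A : List ℕ} : noLoop A = true ↔
    ¬ ent A 8 1 = true ∧ ∀ x < 8, x ≠ 1 → ¬ ent A x x = true := by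
  simp only [noLoop, Bool.and_eq_true, Bool.not_eq_true', Bool.not_eq_true, List.all_eq_true]
  refine and_congr_right fun _ => ⟨fun h x hx h1 => h x ?_, fun h x hx => h x ?_ ?_⟩
  · interval_cases x <;> simp at h1 ⊢
  · simp only [List.mem_cons, List.not_mem_nil, or_false] at hx
    omega
  · simp only [List.mem_cons, List.not_mem_nil, or_false] at hx
    omega

theorem noLoop_iff_not_deviates {n : ℕ} {ℓ : ℕ → Letter} {μ : ℕ → ℕ} (h0 : μ 0 = 1)
    (h8 : ∀ i ≤ n, μ i < 8) (h1 : ∀ i < n, (ℓ i).1 = μ i)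
    (h2 : ∀ i < n, (ℓ i).2.1 = μ (i + 1))
    (hok : ∀ i < n, letterOk (ℓ i) (μ i) (μ (i + 1)) = true) :
    noLoop (wordMat ((List.range n).map ℓ)) = true ↔ ¬ Deviates n ℓ μ := by
  rw [noLoop_iff]
  constructor
  · rintro ⟨hA, hB⟩ ⟨τ, hτn, hτ8, hτ, k, hk, hne⟩
    by_cases hτ0 : τ 0 = 1
    · refine hA ((ent_wordMat_range _ _ _ _).2
        ⟨fun i => if ∀ j ≤ i, τ j = μ j then 8 else τ i, ?_, ?_, by norm_num, fun i hi => ?_⟩)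
      · simp [hτ0, h0]
      · simp only
        rw [if_neg (fun h => hne (h k hk)), hτn, hτ0]
      · rw [transOk_iff]
        beta_reduce
        by_cases hg : ∀ j ≤ i, τ j = μ j
        · by_cases hg' : ∀ j ≤ i + 1, τ j = μ j
          · exact Or.inr ⟨if_pos hg, if_pos hg'⟩
          · refine Or.inl ?_
            rw [if_pos hg, if_neg hg']
            refine ⟨hτ8 _ hi, Or.inr ⟨rfl, ?_, ?_⟩⟩
            · rw [h1 i hi, ← hg i le_rfl]
              exact hτ i hi
            · rw [h2 i hi]
              refine fun h => hg' fun j hj => ?_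
              rcases Nat.le_succ_iff.1 hj with hj | rfl
              · exact hg j hj
              · exact h
        · have hg' : ¬ ∀ j ≤ i + 1, τ j = μ j := fun h => hg fun j hj => h j (by omega)
          rw [if_neg hg, if_neg hg']
          exact Or.inl ⟨hτ8 _ hi, Or.inl ⟨hτ8 _ hi.le, hτ i hi⟩⟩
    · refine hB (τ 0) (hτ8 0 (Nat.zero_le _)) hτ0 ((ent_wordMat_range _ _ _ _).2
        ⟨τ, rfl, hτn, by have := hτ8 0 (Nat.zero_le _); omega, fun i hi => ?_⟩)
      rw [transOk_iff]
      exact Or.inl ⟨hτ8 _ hi, Or.inl ⟨hτ8 _ hi.le, hτ i hi⟩⟩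
  · intro hdev
    constructor
    · intro h
      obtain ⟨σ, hσ0, hσn, -, hσ⟩ := (ent_wordMat_range _ _ _ _).1 h
      have hle : ∀ i ≤ n, σ i ≤ 8 := by
        intro i hi
        cases i with
        | zero => omega
        | succ i => have := (transOk_lt (hσ i hi)).2; omega
      refine hdev ⟨fun i => if σ i = 8 then μ i else σ i, by simp [hσ0, hσn, h0], ?_, ?_, ?_⟩
      · intro i hi
        have := hle i hi
        have := h8 i hi
        simp only
        split_ifs <;> omega
      · intro i hi
        rcases transOk_iff.1 (hσ i hi) with ⟨hy, ⟨hx, h⟩ | ⟨hx, h, -⟩⟩ | ⟨hx, hy⟩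
        · simpa [hx.ne, hy.ne] using h
        · rw [h1 i hi] at h
          simpa [hx, hy.ne] using h
        · simpa [hx, hy] using hok i hi
      · have hex : ∃ i, i < n ∧ σ i = 8 ∧ σ (i + 1) ≠ 8 := by
          by_contra! hall
          have : ∀ i ≤ n, σ i = 8 := by
            intro i hi
            induction i with
            | zero => exact hσ0
            | succ i ih => exact hall i hi (ih (by omega))
          have := this n le_rfl
          omega
        obtain ⟨i, hi, hx, hy⟩ := hex
        refine ⟨i + 1, hi, ?_⟩
        beta_reduce
        rw [if_neg hy]
        rcases transOk_iff.1 (hσ i hi) with ⟨-, ⟨hx', -⟩ | ⟨-, -, h⟩⟩ | ⟨-, hy'⟩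
        · omega
        · rwa [h2 i hi] at h
        · exact absurd hy' hy
    · intro x hx hx1 h
      obtain ⟨σ, hσ0, hσn, -, hσ⟩ := (ent_wordMat_range _ _ _ _).1 h
      have hlt : ∀ i ≤ n, σ i < 8 := by
        intro i hi
        induction i with
        | zero => omega
        | succ i ih =>
          have := ih (by omega)
          rcases transOk_iff.1 (hσ i hi) with ⟨hy, -⟩ | ⟨hx, -⟩
          · exact hy
          · omega
      refine hdev ⟨σ, by rw [hσ0, hσn], hlt, fun i hi => ?_, 0, Nat.zero_le _, by omega⟩
      have := hlt i hi.le
      rcases transOk_iff.1 (hσ i hi) with ⟨-, ⟨-, h⟩ | ⟨hx, -⟩⟩ | ⟨hx, -⟩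
      · exact h
      · omega
      · omega

theorem isForcingSet_iff_noLoop {n : ℕ} (hn : 5 ≤ n) {M : (petersen n).Subgraph}
    (hM : M.IsPerfectMatching) {μ : ℕ → ℕ} (hμ : Traces M μ) {S : Set (Sym2 (PV n))}
    (hS : S ⊆ M.edgeSet) :
    IsForcingSet (petersen n) M S ↔
      noLoop (wordMat ((List.range n).map (letterOf μ S))) = true := by
  rw [isForcingSet_iff hn hM hμ hS, noLoop_iff_not_deviates hμ.zero hμ.lt
    (fun _ _ => rfl) (fun _ _ => rfl) fun i hi => letterOk_iff.2 ⟨hμ.step i hi, fun t ht => ?_⟩]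
  rw [← hμ.uses_eq i hi, uses_iff]
  exact hS (pres_letterOf.1 ht)

/-! ### Number of prescribed edges -/

theorem ncard_eq_wordCost {n : ℕ} (hn : 5 ≤ n) {M : (petersen n).Subgraph} (μ : ℕ → ℕ)
    {S : Set (Sym2 (PV n))} (hS : S ⊆ M.edgeSet) :
    S.ncard = wordCost ((List.range n).map (letterOf μ S)) := by
  classical
  have : NeZero n := ⟨by omega⟩
  set E := (Finset.range n ×ˢ (Finset.univ : Finset (Fin 3))).filter
    (fun p => pres (letterOf μ S p.1) p.2 = true) with hE
  have hSE : S = ↑(E.image fun p => edg p.2 (p.1 : ZMod n)) := by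
    ext e
    simp only [hE, Finset.coe_image, Set.mem_image, Finset.mem_coe, Finset.mem_filter,
      Finset.mem_product, Finset.mem_range, Finset.mem_univ, and_true, pres_letterOf]
    constructor
    · intro he
      obtain ⟨t, i, rfl⟩ := exists_edg hn (hS he)
      exact ⟨(i.val, t), ⟨ZMod.val_lt i, by rwa [ZMod.natCast_zmod_val]⟩,
        by rw [ZMod.natCast_zmod_val]⟩
    · rintro ⟨p, ⟨-, h⟩, rfl⟩
      exact h
  have hinj : Set.InjOn (fun p : ℕ × Fin 3 => edg p.2 (p.1 : ZMod n)) E := by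
    rintro ⟨i, t⟩ hp ⟨j, t'⟩ hq h
    simp only [hE, Finset.coe_filter, Finset.mem_product, Finset.mem_range, Set.mem_ofPred_eq]
      at hp hq
    obtain ⟨rfl, hij⟩ := (edg_inj hn).1 h
    have := congrArg ZMod.val hij
    rw [ZMod.val_natCast_of_lt hp.1.1, ZMod.val_natCast_of_lt hq.1.1] at this
    rw [this]
  have hcost : ∀ l : Letter, letterCost l = ∑ t, if pres l t = true then 1 else 0 := by
    rintro ⟨x, y, a, b, c⟩
    rw [Fin.sum_univ_three]
    cases a <;> cases b <;> cases c <;> rfl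
  have hsum : ∀ (f : ℕ → ℕ) (m : ℕ), ((List.range m).map f).sum = ∑ i ∈ Finset.range m, f i := by
    intro f m
    induction m with
    | zero => rfl
    | succ m ih =>
      rw [List.range_succ, Finset.sum_range_succ, List.map_append, List.sum_append, ih]
      rfl
  rw [hSE, Set.ncard_coe_finset, Finset.card_image_of_injOn hinj, hE, Finset.card_filter,
    Finset.sum_product, ← hSE, wordCost, List.map_map, hsum]
  exact Finset.sum_congr rfl fun i _ => (hcost _).symm

/-! ### The matching `D^d C^c` -/

/-- The states of the matching `D^d C^c`. -/
def dcState (d i : ℕ) : ℕ :=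
  if i < 4 * d then [1, 2, 7, 4].getD (i % 4) 0 else [1, 2, 4].getD ((i - 4 * d) % 3) 0

/-- The states before and after a position. -/
def statePair (l : Letter) : ℕ × ℕ := (l.1, l.2.1)

/-- The consecutive pairs of states of a block `D`. -/
def pairsD : List (ℕ × ℕ) := [(1, 2), (2, 7), (7, 4), (4, 1)]

/-- The consecutive pairs of states of a block `C`. -/
def pairsC : List (ℕ × ℕ) := [(1, 2), (2, 4), (4, 1)]

theorem dcState_pairD {d j r : ℕ} (hj : j < d) (hr : r < 4) :
    (dcState d (4 * j + r), dcState d (4 * j + r + 1)) = pairsD.getD r (0, 0) := by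
  have h1 : 4 * j + r < 4 * d := by omega
  have h2 : (4 * j + r) % 4 = r := by omega
  rw [dcState, if_pos h1, h2, dcState]
  by_cases h3 : r = 3
  · subst h3
    by_cases h4 : 4 * j + 3 + 1 < 4 * d
    · have h5 : (4 * j + 3 + 1) % 4 = 0 := by omega
      rw [if_pos h4, h5]
      rfl
    · have h5 : (4 * j + 3 + 1 - 4 * d) % 3 = 0 := by omega
      rw [if_neg h4, h5]
      rfl
  · have h4 : 4 * j + r + 1 < 4 * d := by omega
    have h5 : (4 * j + r + 1) % 4 = r + 1 := by omega
    rw [if_pos h4, h5]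
    interval_cases r
    · rfl
    · rfl
    · rfl
    · exact absurd rfl h3

theorem dcState_pairC {d j r : ℕ} (hr : r < 3) :
    (dcState d (4 * d + (3 * j + r)), dcState d (4 * d + (3 * j + r) + 1)) =
      pairsC.getD r (0, 0) := by
  have h1 : ¬ 4 * d + (3 * j + r) < 4 * d := by omega
  have h2 : (4 * d + (3 * j + r) - 4 * d) % 3 = r := by omega
  have h3 : ¬ 4 * d + (3 * j + r) + 1 < 4 * d := by omega
  have h4 : (4 * d + (3 * j + r) + 1 - 4 * d) % 3 = (r + 1) % 3 := by omega
  rw [dcState, if_neg h1, h2, dcState, if_neg h3, h4]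
  interval_cases r <;> rfl

theorem exists_position {d c i : ℕ} (hi : i < 4 * d + 3 * c) :
    (∃ j < d, ∃ r < 4, i = 4 * j + r) ∨ ∃ j < c, ∃ r < 3, i = 4 * d + (3 * j + r) := by
  by_cases h : i < 4 * d
  · exact Or.inl ⟨i / 4, by omega, i % 4, by omega, by omega⟩
  · exact Or.inr ⟨(i - 4 * d) / 3, by omega, (i - 4 * d) % 3, by omega, by omega⟩

theorem dcState_lt_step {d c i : ℕ} (hi : i < 4 * d + 3 * c) :
    dcState d i < 8 ∧ dcState d (i + 1) < 8 ∧
      stepOk (dcState d i) (dcState d (i + 1)) = true := by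
  rcases exists_position hi with ⟨j, hj, r, hr, rfl⟩ | ⟨j, hj, r, hr, rfl⟩
  · have h := dcState_pairD hj hr
    obtain ⟨h1, h2⟩ := Prod.ext_iff.1 h
    simp only at h1 h2
    rw [h1, h2]
    interval_cases r <;> decide
  · have h := dcState_pairC (d := d) (j := j) hr
    obtain ⟨h1, h2⟩ := Prod.ext_iff.1 h
    simp only at h1 h2
    rw [h1, h2]
    interval_cases r <;> decide

theorem natCast_inj_of_lt {n i k : ℕ} (hi : i < n) (hk : k < n) :
    (i : ZMod n) = (k : ZMod n) ↔ i = k := by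
  refine ⟨fun h => ?_, fun h => h ▸ rfl⟩
  have := congrArg ZMod.val h
  rwa [ZMod.val_natCast_of_lt hi, ZMod.val_natCast_of_lt hk] at this

theorem edg_natCast_eq {n i k : ℕ} (hn : 5 ≤ n) (hi : i < n) (hk : k < n) {t t' : Fin 3} :
    edg t (i : ZMod n) = edg t' (k : ZMod n) ↔ t.val = t'.val ∧ i = k := by
  rw [edg_inj hn, natCast_inj_of_lt hi hk, Fin.ext_iff]

theorem edg_mem_blockD {n i k : ℕ} (hn : 5 ≤ n) (hi : i < n) (hk : k + 4 ≤ n) {t : Fin 3} :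
    edg t (i : ZMod n) ∈ blockD n (k : ZMod n) ↔ (t.val = 1 ∧ (i = k ∨ i = k + 1)) ∨
      (t.val = 2 ∧ (i = k + 1 ∨ i = k + 3)) := by
  have h : blockD n (k : ZMod n) = {edg 1 ((k : ℕ) : ZMod n), edg 1 ((k + 1 : ℕ) : ZMod n),
      edg 2 ((k + 1 : ℕ) : ZMod n), edg 2 ((k + 3 : ℕ) : ZMod n)} := by
    simp only [blockD, edg]
    push_cast
    ring_nf
  rw [h]
  simp only [Set.mem_insert_iff, Set.mem_singleton_iff]
  rw [edg_natCast_eq hn hi (by omega), edg_natCast_eq hn hi (by omega),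
    edg_natCast_eq hn hi (by omega), edg_natCast_eq hn hi (by omega)]
  simp only [Fin.val_one, Fin.val_two]
  omega

theorem edg_mem_blockC {n i k : ℕ} (hn : 5 ≤ n) (hi : i < n) (hk : k + 3 ≤ n) {t : Fin 3} :
    edg t (i : ZMod n) ∈ blockC n (k : ZMod n) ↔ (t.val = 1 ∧ i = k) ∨
      (t.val = 0 ∧ i = k + 1) ∨ (t.val = 2 ∧ i = k + 2) := by
  have h : blockC n (k : ZMod n) = {edg 1 ((k : ℕ) : ZMod n), edg 0 ((k + 1 : ℕ) : ZMod n),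
      edg 2 ((k + 2 : ℕ) : ZMod n)} := by
    simp only [blockC, edg]
    push_cast
    ring_nf
  rw [h]
  simp only [Set.mem_insert_iff, Set.mem_singleton_iff]
  rw [edg_natCast_eq hn hi (by omega), edg_natCast_eq hn hi (by omega),
    edg_natCast_eq hn hi (by omega)]
  simp only [Fin.val_one, Fin.val_two, Fin.val_zero]

theorem mem_cdEdges_replicate_true {n c : ℕ} (k : ℕ) {e : Sym2 (PV n)} :
    e ∈ cdEdges n (k : ZMod n) (List.replicate c true) ↔
      ∃ j < c, e ∈ blockC n ((k + 3 * j : ℕ) : ZMod n) := by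
  induction c generalizing k with
  | zero => simp [cdEdges]
  | succ c ih =>
    have h : (k : ZMod n) + 3 = ((k + 3 : ℕ) : ZMod n) := by push_cast; rfl
    rw [List.replicate_succ, cdEdges, Set.mem_union, h, ih, Nat.exists_lt_succ_left]
    simp only [mul_zero, add_zero, mul_add, mul_one, add_assoc, add_comm 3]

theorem mem_cdEdges_replicate_false {n d : ℕ} (k : ℕ) (L : List Bool) {e : Sym2 (PV n)} :
    e ∈ cdEdges n (k : ZMod n) (List.replicate d false ++ L) ↔
      (∃ j < d, e ∈ blockD n ((k + 4 * j : ℕ) : ZMod n)) ∨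
        e ∈ cdEdges n ((k + 4 * d : ℕ) : ZMod n) L := by
  induction d generalizing k with
  | zero => simp
  | succ d ih =>
    have h : (k : ZMod n) + 4 = ((k + 4 : ℕ) : ZMod n) := by push_cast; rfl
    rw [List.replicate_succ, List.cons_append, cdEdges, Set.mem_union, h, ih,
      Nat.exists_lt_succ_left, or_assoc]
    simp only [mul_zero, add_zero, mul_add, mul_one, add_assoc, add_comm 4]

section

variable {n d c : ℕ} {M : (petersen n).Subgraph}

theorem edg_mem_dc (hn : 5 ≤ n) (hsum : 4 * d + 3 * c = n)
    (hE : M.edgeSet = cdEdges n 0 (List.replicate d false ++ List.replicate c true)) {i : ℕ}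
    (hi : i < n) {t : Fin 3} : edg t (i : ZMod n) ∈ M.edgeSet ↔
      (i < 4 * d ∧ ((t.val = 1 ∧ (i % 4 = 0 ∨ i % 4 = 1)) ∨
        (t.val = 2 ∧ (i % 4 = 1 ∨ i % 4 = 3)))) ∨
      (4 * d ≤ i ∧ ((t.val = 1 ∧ (i - 4 * d) % 3 = 0) ∨ (t.val = 0 ∧ (i - 4 * d) % 3 = 1) ∨
        (t.val = 2 ∧ (i - 4 * d) % 3 = 2))) := by
  have h0 : (0 : ZMod n) = ((0 : ℕ) : ZMod n) := by simp
  rw [hE, h0, mem_cdEdges_replicate_false, mem_cdEdges_replicate_true]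
  constructor
  · rintro (⟨j, hj, h⟩ | ⟨j, hj, h⟩)
    · rw [edg_mem_blockD hn hi (by omega)] at h
      omega
    · rw [edg_mem_blockC hn hi (by omega)] at h
      omega
  · intro h
    by_cases h4 : i < 4 * d
    · refine Or.inl ⟨i / 4, by omega, ?_⟩
      rw [edg_mem_blockD hn hi (by omega)]
      omega
    · refine Or.inr ⟨(i - 4 * d) / 3, by omega, ?_⟩
      rw [edg_mem_blockC hn hi (by omega)]
      omega

theorem traces_dc (hn : 5 ≤ n) (hsum : 4 * d + 3 * c = n)
    (hE : M.edgeSet = cdEdges n 0 (List.replicate d false ++ List.replicate c true)) :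
    Traces M (dcState d) := by
  have hzero : dcState d 0 = 1 := by
    unfold dcState
    split_ifs <;> simp
  have hend : dcState d n = 1 := by
    have h1 : ¬ n < 4 * d := by omega
    have h2 : (n - 4 * d) % 3 = 0 := by omega
    rw [dcState, if_neg h1, h2]
    rfl
  refine ⟨by rw [hzero, hend], hzero, fun i hi => ?_, fun i hi => ?_, fun i hi t => ?_⟩
  · rcases hi.lt_or_eq with hi | rfl
    · exact (dcState_lt_step (hsum ▸ hi)).1
    · omega
  · exact (dcState_lt_step (hsum ▸ hi)).2.2
  · rw [Bool.eq_iff_iff, uses_iff, edg_mem_dc hn hsum hE hi]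
    have ht : (t = 0 ∧ t.val = 0) ∨ (t = 1 ∧ t.val = 1) ∨ (t = 2 ∧ t.val = 2) := by
      fin_cases t <;> simp
    rcases exists_position (hsum ▸ hi) with ⟨j, hj, r, hr, rfl⟩ | ⟨j, hj, r, hr, rfl⟩
    · obtain ⟨h1, h2⟩ := Prod.ext_iff.1 (dcState_pairD hj hr)
      simp only at h1 h2
      rw [h1, h2]
      rcases ht with ⟨ht, hv⟩ | ⟨ht, hv⟩ | ⟨ht, hv⟩ <;> interval_cases r <;>
        first
        | exact iff_of_true (by omega) (by rw [ht]; decide)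
        | exact iff_of_false (by omega) (by rw [ht]; decide)
    · obtain ⟨h1, h2⟩ := Prod.ext_iff.1 (dcState_pairC (d := d) (j := j) hr)
      simp only at h1 h2
      rw [h1, h2]
      rcases ht with ⟨ht, hv⟩ | ⟨ht, hv⟩ | ⟨ht, hv⟩ <;> interval_cases r <;>
        first
        | exact iff_of_true (by omega) (by rw [ht]; decide)
        | exact iff_of_false (by omega) (by rw [ht]; decide)

end

/-! ### Words of `D^d C^c` -/

/-- All prescribed edges belong to the given matching. -/
def Sound (l : Letter) : Prop := ∀ t, pres l t = true → lab t l.1 l.2.1 = true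

theorem choicesD_spec {b : List Letter} (hb : b ∈ choicesD) :
    b.map statePair = pairsD ∧ ∀ l ∈ b, Sound l := by
  revert b
  unfold Sound
  decide

theorem choicesC_spec {b : List Letter} (hb : b ∈ choicesC) :
    b.map statePair = pairsC ∧ ∀ l ∈ b, Sound l := by
  revert b
  unfold Sound
  decide

theorem Sound.pres_eq_false {x y : ℕ} {a b c : Bool} (h : Sound (x, y, a, b, c)) {t : Fin 3}
    (ht : lab t x y = false) : pres (x, y, a, b, c) t = false := by
  by_contra hp
  have h' : lab t x y = true := h t (by simpa using hp)
  rw [h'] at ht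
  exact absurd ht (by decide)

theorem mem_choicesD {l₀ l₁ l₂ l₃ : Letter} (h : [l₀, l₁, l₂, l₃].map statePair = pairsD)
    (h₀ : Sound l₀) (h₁ : Sound l₁) (h₂ : Sound l₂) (h₃ : Sound l₃) :
    [l₀, l₁, l₂, l₃] ∈ choicesD := by
  obtain ⟨x₀, y₀, a₀, b₀, c₀⟩ := l₀
  obtain ⟨x₁, y₁, a₁, b₁, c₁⟩ := l₁
  obtain ⟨x₂, y₂, a₂, b₂, c₂⟩ := l₂
  obtain ⟨x₃, y₃, a₃, b₃, c₃⟩ := l₃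
  simp only [statePair, pairsD, List.map_cons, List.map_nil, List.cons.injEq, Prod.mk.injEq,
    and_true] at h
  obtain ⟨⟨rfl, rfl⟩, ⟨rfl, rfl⟩, ⟨rfl, rfl⟩, rfl, rfl⟩ := h
  obtain rfl : a₀ = false := h₀.pres_eq_false (t := 0) (by decide)
  obtain rfl : c₀ = false := h₀.pres_eq_false (t := 2) (by decide)
  obtain rfl : a₁ = false := h₁.pres_eq_false (t := 0) (by decide)
  obtain rfl : a₂ = false := h₂.pres_eq_false (t := 0) (by decide)
  obtain rfl : b₂ = false := h₂.pres_eq_false (t := 1) (by decide)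
  obtain rfl : c₂ = false := h₂.pres_eq_false (t := 2) (by decide)
  obtain rfl : a₃ = false := h₃.pres_eq_false (t := 0) (by decide)
  obtain rfl : b₃ = false := h₃.pres_eq_false (t := 1) (by decide)
  exact lettersD_mem b₀ b₁ c₁ c₃

theorem mem_choicesC {l₀ l₁ l₂ : Letter} (h : [l₀, l₁, l₂].map statePair = pairsC)
    (h₀ : Sound l₀) (h₁ : Sound l₁) (h₂ : Sound l₂) : [l₀, l₁, l₂] ∈ choicesC := by
  obtain ⟨x₀, y₀, a₀, b₀, c₀⟩ := l₀
  obtain ⟨x₁, y₁, a₁, b₁, c₁⟩ := l₁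
  obtain ⟨x₂, y₂, a₂, b₂, c₂⟩ := l₂
  simp only [statePair, pairsC, List.map_cons, List.map_nil, List.cons.injEq, Prod.mk.injEq,
    and_true] at h
  obtain ⟨⟨rfl, rfl⟩, ⟨rfl, rfl⟩, rfl, rfl⟩ := h
  obtain rfl : a₀ = false := h₀.pres_eq_false (t := 0) (by decide)
  obtain rfl : c₀ = false := h₀.pres_eq_false (t := 2) (by decide)
  obtain rfl : b₁ = false := h₁.pres_eq_false (t := 1) (by decide)
  obtain rfl : c₁ = false := h₁.pres_eq_false (t := 2) (by decide)
  obtain rfl : a₂ = false := h₂.pres_eq_false (t := 0) (by decide)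
  obtain rfl : b₂ = false := h₂.pres_eq_false (t := 1) (by decide)
  exact lettersC_mem b₀ a₁ c₂

theorem map_range_mul {α : Type*} (f : ℕ → α) (w d : ℕ) : (List.range (w * d)).map f =
    ((List.range d).map fun j => (List.range w).map fun r => f (w * j + r)).flatten := by
  induction d with
  | zero => rfl
  | succ d ih =>
    rw [mul_add, mul_one, List.range_add, List.map_append, ih, List.range_succ, List.map_append,
      List.flatten_append, List.map_map, List.map_singleton, List.flatten_singleton]
    rfl

theorem map_range_dc {α : Type*} (f : ℕ → α) (d c : ℕ) : (List.range (4 * d + 3 * c)).map f =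
    ((List.range d).map fun j => (List.range 4).map fun r => f (4 * j + r)).flatten ++
      ((List.range c).map fun j =>
        (List.range 3).map fun r => f (4 * d + (3 * j + r))).flatten := by
  rw [List.range_add, List.map_append, map_range_mul, List.map_map, map_range_mul]
  rfl

section

variable {n d c : ℕ} {M : (petersen n).Subgraph}

theorem sound_letterOf {μ : ℕ → ℕ} (hμ : Traces M μ) {S : Set (Sym2 (PV n))}
    (hS : S ⊆ M.edgeSet) {i : ℕ} (hi : i < n) : Sound (letterOf μ S i) := fun t ht => by
  have h := hμ.uses_eq i hi t
  rw [uses_iff.2 (hS (pres_letterOf.1 ht))] at h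
  exact h.symm

/-- A set of edges of `D^d C^c` gives a word of blocks. -/
theorem exists_blocks (hsum : 4 * d + 3 * c = n) (hμ : Traces M (dcState d))
    {S : Set (Sym2 (PV n))} (hS : S ⊆ M.edgeSet) :
    ∃ bd bc : List (List Letter), (∀ b ∈ bd, b ∈ choicesD) ∧ (∀ b ∈ bc, b ∈ choicesC) ∧
      bd.length = d ∧ bc.length = c ∧
      (List.range n).map (letterOf (dcState d) S) = bd.flatten ++ bc.flatten := by
  subst hsum
  refine ⟨_, _, ?_, ?_, ?_, ?_, map_range_dc _ d c⟩
  · intro b hb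
    obtain ⟨j, hj, rfl⟩ := List.mem_map.1 hb
    rw [List.mem_range] at hj
    have hs : ∀ r < 4, Sound (letterOf (dcState d) S (4 * j + r)) := fun r hr =>
      sound_letterOf hμ hS (by omega)
    refine mem_choicesD ?_ (hs 0 (by omega)) (hs 1 (by omega)) (hs 2 (by omega))
      (hs 3 (by omega))
    have hp : ∀ r < 4, statePair (letterOf (dcState d) S (4 * j + r)) = pairsD.getD r (0, 0) :=
      fun r hr => dcState_pairD hj hr
    simp only [List.map_cons, List.map_nil, hp 0 (by omega), hp 1 (by omega), hp 2 (by omega),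
      hp 3 (by omega)]
    rfl
  · intro b hb
    obtain ⟨j, hj, rfl⟩ := List.mem_map.1 hb
    rw [List.mem_range] at hj
    have hs : ∀ r < 3, Sound (letterOf (dcState d) S (4 * d + (3 * j + r))) := fun r hr =>
      sound_letterOf hμ hS (by omega)
    refine mem_choicesC ?_ (hs 0 (by omega)) (hs 1 (by omega)) (hs 2 (by omega))
    have hp : ∀ r < 3, statePair (letterOf (dcState d) S (4 * d + (3 * j + r))) =
        pairsC.getD r (0, 0) := fun r hr => dcState_pairC hr
    simp only [List.map_cons, List.map_nil, hp 0 (by omega), hp 1 (by omega), hp 2 (by omega)]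
    rfl
  · rw [List.length_map, List.length_range]
  · rw [List.length_map, List.length_range]

theorem map_eq_map_range {α β : Type*} {f : α → β} {g : ℕ → β} {l : List α} {x : β}
    (hf : ∀ a ∈ l, f a = x) (hg : ∀ j < l.length, g j = x) :
    l.map f = (List.range l.length).map g := by
  rw [List.map_congr_left hf, List.map_congr_left fun j hj => hg j (List.mem_range.1 hj),
    List.map_const', List.map_const', List.length_range]

theorem map_statePair_blocks {bd bc : List (List Letter)} (hbd : ∀ b ∈ bd, b ∈ choicesD)
    (hbc : ∀ b ∈ bc, b ∈ choicesC) (hd : bd.length = d) (hc : bc.length = c) :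
    (bd.flatten ++ bc.flatten).map statePair =
      (List.range (4 * d + 3 * c)).map fun i => (dcState d i, dcState d (i + 1)) := by
  subst hd hc
  have hD : ∀ j < bd.length, ((List.range 4).map fun r =>
      (dcState bd.length (4 * j + r), dcState bd.length (4 * j + r + 1))) = pairsD :=
    fun j hj => List.map_congr_left fun r hr => dcState_pairD hj (List.mem_range.1 hr)
  have hC : ∀ j < bc.length, ((List.range 3).map fun r =>
      (dcState bd.length (4 * bd.length + (3 * j + r)),
        dcState bd.length (4 * bd.length + (3 * j + r) + 1))) = pairsC :=
    fun j _ => List.map_congr_left fun r hr => dcState_pairC (List.mem_range.1 hr)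
  rw [map_range_dc, List.map_append, List.map_flatten, List.map_flatten,
    map_eq_map_range (fun b hb => (choicesD_spec (hbd b hb)).1) hD,
    map_eq_map_range (fun b hb => (choicesC_spec (hbc b hb)).1) hC]

theorem sound_of_mem_blocks {bd bc : List (List Letter)} (hbd : ∀ b ∈ bd, b ∈ choicesD)
    (hbc : ∀ b ∈ bc, b ∈ choicesC) {l : Letter} (hl : l ∈ bd.flatten ++ bc.flatten) : Sound l := by
  rcases List.mem_append.1 hl with hl | hl
  · obtain ⟨b, hb, hl⟩ := List.mem_flatten.1 hl
    exact (choicesD_spec (hbd b hb)).2 l hl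
  · obtain ⟨b, hb, hl⟩ := List.mem_flatten.1 hl
    exact (choicesC_spec (hbc b hb)).2 l hl

/-- Every word with the states of a matching comes from a set of its edges. -/
theorem exists_letterOf_eq (hn : 5 ≤ n) {μ : ℕ → ℕ} (hμ : Traces M μ) {L : List Letter}
    (hL : L.map statePair = (List.range n).map fun i => (μ i, μ (i + 1)))
    (hs : ∀ l ∈ L, Sound l) :
    ∃ S : Set (Sym2 (PV n)), S ⊆ M.edgeSet ∧ (List.range n).map (letterOf μ S) = L := by
  have hlen : L.length = n := by simpa using congrArg List.length hL
  have hpair : ∀ (i : ℕ) (hi : i < L.length), statePair L[i] = (μ i, μ (i + 1)) := by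
    intro i hi
    have h : (L.map statePair)[i]? = some (μ i, μ (i + 1)) := by
      rw [hL, List.getElem?_map, List.getElem?_range (hlen ▸ hi)]
      rfl
    rw [List.getElem?_map, List.getElem?_eq_getElem hi] at h
    exact Option.some.inj h
  refine ⟨{e | ∃ (i : ℕ) (hi : i < L.length) (t : Fin 3),
    pres L[i] t = true ∧ edg t (i : ZMod n) = e}, ?_, ?_⟩
  · rintro _ ⟨i, hi, t, hp, rfl⟩
    rw [← uses_iff, hμ.uses_eq i (hlen ▸ hi)]
    have h := hs _ (List.getElem_mem hi) t hp
    obtain ⟨h1, h2⟩ := Prod.ext_iff.1 (hpair i hi)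
    simp only [statePair] at h1 h2
    rwa [h1, h2] at h
  · refine List.ext_getElem (by simp [hlen]) fun i hi hi' => ?_
    rw [List.getElem_map, List.getElem_range]
    have hmark : ∀ t, mark {e | ∃ (i : ℕ) (hi : i < L.length) (t : Fin 3),
        pres L[i] t = true ∧ edg t (i : ZMod n) = e} t i = pres L[i] t := by
      intro t
      rw [Bool.eq_iff_iff, mark_iff]
      constructor
      · rintro ⟨j, hj, t', hp, h⟩
        obtain ⟨h1, rfl⟩ := (edg_natCast_eq hn (hlen ▸ hj) (hlen ▸ hi')).1 h
        rwa [← Fin.ext h1]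
      · exact fun h => ⟨i, hi', t, h, rfl⟩
    have h := hpair i hi'
    rw [letterOf, hmark, hmark, hmark]
    obtain ⟨h1, h2⟩ := Prod.ext_iff.1 h
    simp only [statePair] at h1 h2
    rw [← h1, ← h2]
    rfl

end

/-- the exact forcing number of the type-2 perfect matching `D^d C^c` of
`P(n,2)` for `n ≥ 37`: `f = ⌈(6d+3c+η(d))/12⌉ + ξ(d,c)` where `η(d) = 9` for even `d`
and `12` for odd `d`, and `ξ(d,c) = 1` iff (`d = 0` and `c ≡ 1 (mod 4)`) or
(`d = 1` and `c ≡ 2 (mod 4)`). The ceiling is written via natural division. -/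
theorem DC_power_forcing (n d c : ℕ) (hn : 37 ≤ n) (hsum : 4 * d + 3 * c = n)
    (M : (petersen n).Subgraph) (hM : M.IsPerfectMatching)
    (hE : M.edgeSet = cdEdges n 0 (List.replicate d false ++ List.replicate c true)) :
    forcingNumber (petersen n) M =
      (6 * d + 3 * c + (if Even d then 9 else 12) + 11) / 12 +
      (if (d = 0 ∧ c % 4 = 1) ∨ (d = 1 ∧ c % 4 = 2) then 1 else 0) := by
  change sInf _ = forcingValue d c
  have h5 : 5 ≤ n := by omega
  have hμ := traces_dc h5 hsum hE
  refine IsLeast.csInf_eq ⟨?_, ?_⟩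
  · obtain ⟨bd, bc, hbd, hbc, hd, hc, hcost, hloop⟩ := hasWord_forcingValue (d := d) (c := c)
      (by omega)
    have hL := map_statePair_blocks hbd hbc hd hc
    rw [hsum] at hL
    obtain ⟨S, hS, hword⟩ := exists_letterOf_eq h5 hμ hL fun l hl =>
      sound_of_mem_blocks hbd hbc hl
    refine ⟨S, ?_, ?_⟩
    · rw [isForcingSet_iff_noLoop h5 hM hμ hS, hword, hloop]
    · rw [ncard_eq_wordCost h5 (dcState d) hS, hword, hcost]
  · rintro k ⟨S, hS, rfl⟩
    obtain ⟨bd, bc, hbd, hbc, rfl, rfl, hword⟩ := exists_blocks hsum hμ hS.1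
    have hloop := (isForcingSet_iff_noLoop h5 hM hμ hS.1).1 hS
    rw [ncard_eq_wordCost h5 _ hS.1, hword]
    rw [hword] at hloop
    exact forcingValue_le hbd hbc (by omega) hloop
end
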